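/- arXiv:1307.5037 — 2 statements merged into one kernel-verified Lean document; each statement's English description precedes it below -/
import Mathlib

section
/- For all real numbers s, t ≥ 0 with s + t = 1, the set Bad(s,t) ⊆ ℝ² is hyperplane absolute winning; that is, for every β with 0 < β < 1/3, Alice has a winning strategy for the β-hyperplane absolute game played on ℝ² with target set Bad(s,t). -/
open Metric Filter

/-- Distance from a real number to the nearest integer. -/
noncomputable def distNearestInt (x : ℝ) : ℝ := |x - ((round x : ℤ) : ℝ)|

/-- The set `Bad(s,t) ⊆ ℝ²` of pairs `(x,y)` such that
`inf_{q ∈ ℕ⁺} max (q^s ‖qx‖) (q^t ‖qy‖) > 0`. -/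
noncomputable def badPair (s t : ℝ) : Set (ℝ × ℝ) :=
  {p | 0 < ⨅ q : ℕ+, max (((q : ℕ) : ℝ) ^ s * distNearestInt (((q : ℕ) : ℝ) * p.1))
      (((q : ℕ) : ℝ) ^ t * distNearestInt (((q : ℕ) : ℝ) * p.2))}

/-- An affine line in ℝ²: a nonempty affine subspace whose direction has dimension 1. -/
def IsLine (L : AffineSubspace ℝ (ℝ × ℝ)) : Prop :=
  (L : Set (ℝ × ℝ)).Nonempty ∧ Module.finrank ℝ L.direction = 1

/-- The closed `γ`-thickening `L^(γ) = {p : dist(p, L) ≤ γ}` of a line `L`. -/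
noncomputable def lineNbhd (L : AffineSubspace ℝ (ℝ × ℝ)) (γ : ℝ) : Set (ℝ × ℝ) :=
  {p | Metric.infDist p (L : Set (ℝ × ℝ)) ≤ γ}

/-- Alice has a winning strategy for the `β`-hyperplane absolute game on ℝ² with target `S`.
A strategy for Alice assigns to each history of Bob's balls (represented as
(center, radius) pairs `h 0, …, h n`) a pair (line, radius of thickening).
The strategy must be legal: whenever Bob's last ball has positive radius, Alice's move is a
line `L` together with `0 < r̃ ≤ β rₙ`.  It is winning if for every sequence of moves of Bob
obeying the rules (`B₀` has positive radius, `r_{n+1} ≥ β rₙ`, and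
`B_{n+1} ⊆ Bₙ \ Lₙ^{(r̃ₙ)}`), either the radii do not tend to `0` (Alice wins by default) or
every point of `⋂ₙ Bₙ` (i.e. the outcome) belongs to `S`. -/
def IsHAWWin (β : ℝ) (S : Set (ℝ × ℝ)) : Prop :=
  ∃ σ : (n : ℕ) → (Fin (n + 1) → (ℝ × ℝ) × ℝ) → AffineSubspace ℝ (ℝ × ℝ) × ℝ,
    (∀ (n : ℕ) (h : Fin (n + 1) → (ℝ × ℝ) × ℝ), 0 < (h (Fin.last n)).2 →
      IsLine (σ n h).1 ∧ 0 < (σ n h).2 ∧ (σ n h).2 ≤ β * (h (Fin.last n)).2) ∧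
    ∀ B : ℕ → (ℝ × ℝ) × ℝ, 0 < (B 0).2 →
      (∀ n : ℕ, β * (B n).2 ≤ (B (n + 1)).2 ∧
        closedBall (B (n + 1)).1 (B (n + 1)).2 ⊆
          closedBall (B n).1 (B n).2 \
            lineNbhd (σ n (fun i => B i.1)).1 (σ n (fun i => B i.1)).2) →
      (¬ Tendsto (fun n => (B n).2) atTop (nhds 0)) ∨
        ∀ x : ℝ × ℝ, (∀ n : ℕ, x ∈ closedBall (B n).1 (B n).2) → x ∈ S

/-- The affine function `a x + b y + c` with coefficients `f = (a, b, c)`. -/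
def affineForm (f : ℝ × ℝ × ℝ) (p : ℝ × ℝ) : ℝ := f.1 * p.1 + f.2.1 * p.2 + f.2.2

/-- The strip of points where the normalized affine function `f` is at most `γ` in absolute
value. -/
def affineStrip (f : ℝ × ℝ × ℝ) (γ : ℝ) : Set (ℝ × ℝ) :=
  {p | |affineForm f p| ≤ γ * max |f.1| |f.2.1|}

lemma abs_affineForm_sub_le (f : ℝ × ℝ × ℝ) {p q : ℝ × ℝ} {r : ℝ} (h : dist p q ≤ r) :
    |affineForm f p - affineForm f q| ≤ 2 * r * max |f.1| |f.2.1| := by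
  rw [Prod.dist_eq, max_le_iff, Real.dist_eq, Real.dist_eq] at h
  have e : affineForm f p - affineForm f q
      = f.1 * (p.1 - q.1) + f.2.1 * (p.2 - q.2) := by
    unfold affineForm; ring
  have h1 : |f.1 * (p.1 - q.1)| ≤ max |f.1| |f.2.1| * r := by
    rw [abs_mul]
    exact mul_le_mul (le_max_left _ _) h.1 (abs_nonneg _) (by positivity)
  have h2 : |f.2.1 * (p.2 - q.2)| ≤ max |f.1| |f.2.1| * r := by
    rw [abs_mul]
    exact mul_le_mul (le_max_right _ _) h.2 (abs_nonneg _) (by positivity)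
  rw [e]
  linarith [abs_add_le (f.1 * (p.1 - q.1)) (f.2.1 * (p.2 - q.2))]

/-- Two vectors on which a nonzero linear form is small span a parallelogram of small area. -/
lemma abs_det_le_of_form_small {a b ε K : ℝ} {u v : ℝ × ℝ} (hN : 0 < max |a| |b|)
    (hu : |a * u.1 + b * u.2| ≤ ε * max |a| |b|) (hv : |a * v.1 + b * v.2| ≤ ε * max |a| |b|)
    (hu' : ‖u‖ ≤ K) (hv' : ‖v‖ ≤ K) :
    |u.1 * v.2 - u.2 * v.1| ≤ 2 * ε * K := by
  rw [Prod.norm_def, max_le_iff, Real.norm_eq_abs, Real.norm_eq_abs] at hu' hv'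
  have hεN := (abs_nonneg _).trans hu
  have key : ∀ x y : ℝ, |x| ≤ K → |y| ≤ K →
      |(a * u.1 + b * u.2) * y - (a * v.1 + b * v.2) * x| ≤ 2 * ε * K * max |a| |b| := by
    intro x y hx hy
    refine (abs_sub _ _).trans ?_
    rw [abs_mul, abs_mul]
    have := mul_le_mul hu hy (abs_nonneg _) hεN
    have := mul_le_mul hv hx (abs_nonneg _) hεN
    linarith
  have hfin : ∀ w : ℝ, |w| = max |a| |b| →
      |w * (u.1 * v.2 - u.2 * v.1)| ≤ 2 * ε * K * max |a| |b| →
      |u.1 * v.2 - u.2 * v.1| ≤ 2 * ε * K := by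
    intro w hw h
    rw [abs_mul, hw, mul_comm] at h
    exact le_of_mul_le_mul_right h hN
  rcases le_total |a| |b| with h | h
  · refine hfin b (by rw [max_eq_right h]) ?_
    have e : b * (u.1 * v.2 - u.2 * v.1)
        = -((a * u.1 + b * u.2) * v.1 - (a * v.1 + b * v.2) * u.1) := by ring
    rw [e, abs_neg]
    exact key _ _ hu'.1 hv'.1
  · refine hfin a (by rw [max_eq_left h]) ?_
    have e : a * (u.1 * v.2 - u.2 * v.1)
        = (a * u.1 + b * u.2) * v.2 - (a * v.1 + b * v.2) * u.2 := by ring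
    rw [e]
    exact key _ _ hu'.2 hv'.2

lemma isLine_mk' (x : ℝ × ℝ) {u : ℝ × ℝ} (hu : u ≠ 0) :
    IsLine (AffineSubspace.mk' x (Submodule.span ℝ {u})) := by
  refine ⟨⟨x, AffineSubspace.self_mem_mk' _ _⟩, ?_⟩
  rw [AffineSubspace.direction_mk']
  exact finrank_span_singleton hu

lemma infDist_mk'_mul_le (x y u : ℝ × ℝ) :
    infDist y (AffineSubspace.mk' x (Submodule.span ℝ {u}) : Set (ℝ × ℝ)) * ‖u‖
      ≤ |u.1 * (y - x).2 - u.2 * (y - x).1| := by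
  have hmem : ∀ c : ℝ, c • u + x ∈ (AffineSubspace.mk' x (Submodule.span ℝ {u}) : Set (ℝ × ℝ)) := by
    intro c
    rw [SetLike.mem_coe, AffineSubspace.mem_mk']
    simpa using Submodule.smul_mem _ c (Submodule.mem_span_singleton_self u)
  rcases le_total |u.1| |u.2| with h | h
  · by_cases h0 : u.2 = 0
    · have h1 : u.1 = 0 := by simpa [h0] using h
      have : u = 0 := Prod.ext h1 h0
      simp [this]
    · have hn : ‖u‖ = |u.2| := by
        rw [Prod.norm_def, Real.norm_eq_abs, Real.norm_eq_abs, max_eq_right h]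
      rw [hn, ← le_div_iff₀ (abs_pos.2 h0), ← abs_div]
      refine (infDist_le_dist_of_mem (hmem ((y - x).2 / u.2))).trans ?_
      rw [Prod.dist_eq, Real.dist_eq, Real.dist_eq]
      refine max_le ?_ ?_
      · rw [← abs_neg]
        apply le_of_eq; congr 1
        simp; field_simp; ring
      · have : y.2 - ((y - x).2 / u.2 * u.2 + x.2) = 0 := by
          rw [div_mul_cancel₀ _ h0]; simp
        simp only [Prod.snd_add, Prod.smul_snd, smul_eq_mul]
        rw [this, abs_zero]; positivity
  · by_cases h0 : u.1 = 0
    · have h1 : u.2 = 0 := by simpa [h0] using h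
      have : u = 0 := Prod.ext h0 h1
      simp [this]
    · have hn : ‖u‖ = |u.1| := by
        rw [Prod.norm_def, Real.norm_eq_abs, Real.norm_eq_abs, max_eq_left h]
      rw [hn, ← le_div_iff₀ (abs_pos.2 h0), ← abs_div]
      refine (infDist_le_dist_of_mem (hmem ((y - x).1 / u.1))).trans ?_
      rw [Prod.dist_eq, Real.dist_eq, Real.dist_eq]
      refine max_le ?_ ?_
      · have : y.1 - ((y - x).1 / u.1 * u.1 + x.1) = 0 := by
          rw [div_mul_cancel₀ _ h0]; simp
        simp only [Prod.fst_add, Prod.smul_fst, smul_eq_mul]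
        rw [this, abs_zero]; positivity
      · apply le_of_eq; congr 1
        simp; field_simp; ring

/-- A strip meeting three small balls forces the third center to be close to the line through
the first two, as soon as the first two centers are well separated. -/
lemma infDist_le_of_strip_meets {β δ r γ : ℝ} {f : ℝ × ℝ × ℝ} {x₁ x₂ x₃ : ℝ × ℝ}
    (hβ : 0 < β) (hr : 0 < r) (hδ : δ * 100 ≤ β ^ 2)
    (hf : 0 < max |f.1| |f.2.1|) (hγ : γ ≤ δ * r)
    (h₁ : (closedBall x₁ (δ * r) ∩ affineStrip f γ).Nonempty)
    (h₂ : (closedBall x₂ (δ * r) ∩ affineStrip f γ).Nonempty)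
    (h₃ : (closedBall x₃ (δ * r) ∩ affineStrip f γ).Nonempty)
    (h₁₂ : dist x₂ x₁ ≤ 2 * r) (h₁₃ : dist x₃ x₁ ≤ 2 * r) (hsep : β * r / 4 < dist x₂ x₁) :
    infDist x₃ (AffineSubspace.mk' x₁ (Submodule.span ℝ {x₂ - x₁}) : Set (ℝ × ℝ)) ≤ β * r := by
  have hval : ∀ x, (closedBall x (δ * r) ∩ affineStrip f γ).Nonempty →
      |affineForm f x| ≤ 3 * δ * r * max |f.1| |f.2.1| := by
    rintro x ⟨y, hy, hys⟩
    have h1 := abs_affineForm_sub_le f (mem_closedBall.1 hy)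
    have h2 : |affineForm f y| ≤ γ * max |f.1| |f.2.1| := hys
    have h3 := mul_le_mul_of_nonneg_right hγ hf.le
    have h4 := abs_sub_abs_le_abs_sub (affineForm f x) (affineForm f y)
    rw [abs_sub_comm] at h4
    linarith
  have hdiff : ∀ x, (closedBall x (δ * r) ∩ affineStrip f γ).Nonempty →
      |f.1 * (x - x₁).1 + f.2.1 * (x - x₁).2| ≤ 6 * δ * r * max |f.1| |f.2.1| := by
    intro x hx
    have e : f.1 * (x - x₁).1 + f.2.1 * (x - x₁).2 = affineForm f x - affineForm f x₁ := by
      simp [affineForm]; ring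
    rw [e]
    linarith [abs_sub (affineForm f x) (affineForm f x₁), hval x hx, hval x₁ h₁]
  have hdet := abs_det_le_of_form_small (K := 2 * r) hf (hdiff x₂ h₂) (hdiff x₃ h₃)
    (by rwa [← dist_eq_norm]) (by rwa [← dist_eq_norm])
  have hinf := (infDist_mk'_mul_le x₁ x₃ (x₂ - x₁)).trans hdet
  rw [← dist_eq_norm] at hinf
  by_contra! hcon
  have h1 : β * r * (β * r / 4) < 2 * (6 * δ * r) * (2 * r) :=
    (mul_lt_mul'' hcon hsep (by positivity) (by positivity)).trans_le hinf
  have h2 : δ * 100 * r ^ 2 ≤ β ^ 2 * r ^ 2 := mul_le_mul_of_nonneg_right hδ (by positivity)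
  nlinarith [sq_pos_of_pos hr, mul_pos hβ hβ, mul_pos (mul_pos hβ hβ) (sq_pos_of_pos hr)]

open Classical in
/-- The total weight of those sets `T i`, `i ∈ I`, that meet `K`. -/
noncomputable def meetWeight {ι α : Type*} (I : Finset ι) (w : ι → ℝ) (T : ι → Set α)
    (K : Set α) : ℝ :=
  ∑ i ∈ I, if (K ∩ T i).Nonempty then w i else 0

lemma le_meetWeight {ι α : Type*} {I : Finset ι} {w : ι → ℝ} {T : ι → Set α} {K : Set α}
    (hw : ∀ i ∈ I, 0 ≤ w i) {i : ι} (hi : i ∈ I) (h : (K ∩ T i).Nonempty) :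
    w i ≤ meetWeight I w T K := by
  classical
  have := Finset.single_le_sum (f := fun i => if (K ∩ T i).Nonempty then w i else 0)
    (fun j hj => by
      by_cases hj' : (K ∩ T j).Nonempty
      · simpa [hj'] using hw j hj
      · simp [hj']) hi
  simpa [meetWeight, h] using this

lemma meetWeight_le_sum {ι α : Type*} {I : Finset ι} {w : ι → ℝ} {T : ι → Set α} {K : Set α}
    (hw : ∀ i ∈ I, 0 ≤ w i) : meetWeight I w T K ≤ ∑ i ∈ I, w i := by
  unfold meetWeight
  refine Finset.sum_le_sum fun i hi => ?_
  split_ifs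
  exacts [le_rfl, hw i hi]

/-- If no set `T i` that meets three subsets of `K` at once, then the weights of those three
subsets add up to at most twice the weight of `K`. -/
lemma meetWeight_add_add_le {ι α : Type*} {I : Finset ι} {w : ι → ℝ} {T : ι → Set α}
    {K K₁ K₂ K₃ : Set α} (hw : ∀ i ∈ I, 0 ≤ w i) (h₁ : K₁ ⊆ K) (h₂ : K₂ ⊆ K) (h₃ : K₃ ⊆ K)
    (h : ∀ i ∈ I, (K₁ ∩ T i).Nonempty → (K₂ ∩ T i).Nonempty → ¬ (K₃ ∩ T i).Nonempty) :
    meetWeight I w T K₁ + meetWeight I w T K₂ + meetWeight I w T K₃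
      ≤ 2 * meetWeight I w T K := by
  unfold meetWeight
  rw [← Finset.sum_add_distrib, ← Finset.sum_add_distrib, Finset.mul_sum]
  refine Finset.sum_le_sum fun i hi => ?_
  have hwi := hw i hi
  have hi' := h i hi
  by_cases hK : (K ∩ T i).Nonempty
  · rw [if_pos hK]
    split_ifs <;> first | linarith | tauto
  · have hsub : ∀ S ⊆ K, ¬ (S ∩ T i).Nonempty := fun S hS hne =>
      hK (hne.mono (Set.inter_subset_inter_left _ hS))
    simp [hsub _ h₁, hsub _ h₂, hsub _ h₃, hK]

/-- Given finitely many weighted thin strips, Alice has a line such that every small ball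
avoiding the neighborhood of this line meets at most two thirds of the weight. -/
lemma exists_line_meetWeight_le {ι : Type*} (I : Finset ι) {w : ι → ℝ} {f : ι → ℝ × ℝ × ℝ}
    {γ : ι → ℝ} {β δ r : ℝ} (x : ℝ × ℝ) (hβ : 0 < β) (hr : 0 < r) (hδ : δ * 100 ≤ β ^ 2)
    (hw : ∀ i ∈ I, 0 ≤ w i) (hf : ∀ i ∈ I, 0 < max |(f i).1| |(f i).2.1|)
    (hγ : ∀ i ∈ I, (closedBall x r ∩ affineStrip (f i) (γ i)).Nonempty → γ i ≤ δ * r) :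
    ∃ L, IsLine L ∧ ∀ (x' : ℝ × ℝ) (r' : ℝ), 0 ≤ r' → r' ≤ δ * r →
      closedBall x' r' ⊆ closedBall x r \ lineNbhd L (β * r) →
      meetWeight I w (fun i => affineStrip (f i) (γ i)) (closedBall x' r')
        ≤ 2 / 3 * meetWeight I w (fun i => affineStrip (f i) (γ i)) (closedBall x r) := by
  set W : Set (ℝ × ℝ) → ℝ := meetWeight I w (fun i => affineStrip (f i) (γ i)) with hW
  let Heavy : (ℝ × ℝ) → ℝ → Prop := fun y ρ =>
    0 ≤ ρ ∧ ρ ≤ δ * r ∧ closedBall y ρ ⊆ closedBall x r ∧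
      2 / 3 * W (closedBall x r) < W (closedBall y ρ)
  by_cases hex : ∃ y₁ ρ₁ y₂ ρ₂, Heavy y₁ ρ₁ ∧ Heavy y₂ ρ₂ ∧ β * r / 4 < dist y₂ y₁
  · obtain ⟨y₁, ρ₁, y₂, ρ₂, ⟨h01, hρ₁, hs₁, hh₁⟩, ⟨h02, hρ₂, hs₂, hh₂⟩, hsep⟩ := hex
    have hne : y₂ - y₁ ≠ 0 := by
      intro h0
      rw [sub_eq_zero.1 h0, dist_self] at hsep
      nlinarith [mul_pos hβ hr]
    refine ⟨_, isLine_mk' y₁ hne, fun x' r' h0' hr' hsub => ?_⟩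
    have hs₃ : closedBall x' r' ⊆ closedBall x r := fun p hp => (hsub hp).1
    have hc₁ := mem_closedBall.1 (hs₁ (mem_closedBall_self h01))
    have hc₂ := mem_closedBall.1 (hs₂ (mem_closedBall_self h02))
    have hc₃ := mem_closedBall.1 (hs₃ (mem_closedBall_self h0'))
    have := meetWeight_add_add_le (T := fun i => affineStrip (f i) (γ i)) hw hs₁ hs₂ hs₃ ?_
    · rw [← hW] at this
      linarith
    intro i hi m₁ m₂ m₃
    refine (hsub (mem_closedBall_self h0')).2 ?_
    refine infDist_le_of_strip_meets hβ hr hδ (hf i hi)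
      (hγ i hi (m₁.mono (Set.inter_subset_inter_left _ hs₁)))
      (m₁.mono (Set.inter_subset_inter_left _ (closedBall_subset_closedBall hρ₁)))
      (m₂.mono (Set.inter_subset_inter_left _ (closedBall_subset_closedBall hρ₂)))
      (m₃.mono (Set.inter_subset_inter_left _ (closedBall_subset_closedBall hr'))) ?_ ?_ hsep
    · linarith [dist_triangle_right y₂ y₁ x]
    · linarith [dist_triangle_right x' y₁ x]
  · push Not at hex
    have hu : ((1, 0) : ℝ × ℝ) ≠ 0 := by simp
    by_cases hh : ∃ y ρ, Heavy y ρ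
    · obtain ⟨y, ρ, hy⟩ := hh
      refine ⟨_, isLine_mk' y hu, fun x' r' h0' hr' hsub => ?_⟩
      by_contra! hcon
      refine (hsub (mem_closedBall_self h0')).2 ?_
      have hd := hex y ρ x' r' hy ⟨h0', hr', fun p hp => (hsub hp).1, hcon⟩
      refine (infDist_le_dist_of_mem (AffineSubspace.self_mem_mk' y _)).trans (hd.trans ?_)
      linarith [mul_pos hβ hr]
    · push Not at hh
      refine ⟨_, isLine_mk' 0 hu, fun x' r' h0' hr' hsub => ?_⟩
      by_contra! hcon
      exact hh x' r' ⟨h0', hr', fun p hp => (hsub hp).1, hcon⟩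

/-- The first index at which the radius of the ball is at most `R ^ (-m)` times the initial
radius. -/
noncomputable def levelIndex (R : ℝ) (B : ℕ → (ℝ × ℝ) × ℝ) (m : ℕ) : ℕ :=
  sInf {n | (B n).2 ≤ (B 0).2 / R ^ m}

/-- The strip attached to the pair `i = (m, k)` in the play `B`: its line depends on the ball of
level `m`, and its relative thickness is of order `R ^ (-(m + k))`. -/
noncomputable def levelStrip (R θ : ℝ) (F : ℝ → ℕ → ℕ → (ℝ × ℝ) × ℝ → ℝ × ℝ × ℝ)
    (B : ℕ → (ℝ × ℝ) × ℝ) (i : (_ : ℕ) × ℕ) : Set (ℝ × ℝ) :=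
  affineStrip (F (B 0).2 i.1 i.2 (B (levelIndex R B i.1))) (θ * (B 0).2 / R ^ (i.1 + i.2))

/-- The weight of all strips of level at most `m` that meet `K`. -/
noncomputable def potential (R θ : ℝ) (F : ℝ → ℕ → ℕ → (ℝ × ℝ) × ℝ → ℝ × ℝ × ℝ)
    (B : ℕ → (ℝ × ℝ) × ℝ) (m : ℕ) (K : Set (ℝ × ℝ)) : ℝ :=
  meetWeight ((Finset.range (m + 1)).sigma fun i => Finset.range (i + 1))
    (fun i => (5 / 6 : ℝ) ^ (i.1 + i.2)) (levelStrip R θ F B) K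

/-- Deleting the neighborhood of `L` on turn `n` reduces the potential of subsequent small balls by
a factor `2 / 3`. -/
def IsGoodLine (β δ R θ : ℝ) (F : ℝ → ℕ → ℕ → (ℝ × ℝ) × ℝ → ℝ × ℝ × ℝ)
    (B : ℕ → (ℝ × ℝ) × ℝ) (n : ℕ) (L : AffineSubspace ℝ (ℝ × ℝ)) : Prop :=
  ∀ m, β * ((B 0).2 / R ^ m) ≤ (B n).2 → (B n).2 ≤ (B 0).2 / R ^ m →
    potential R θ F B m (closedBall (B n).1 (B n).2) ≤ 30 * (5 / 6) ^ m →
    ∀ (x : ℝ × ℝ) (r : ℝ), 0 ≤ r → r ≤ δ * (B n).2 →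
      closedBall x r ⊆ closedBall (B n).1 (B n).2 \ lineNbhd L (β * (B n).2) →
      potential R θ F B m (closedBall x r)
        ≤ 2 / 3 * potential R θ F B m (closedBall (B n).1 (B n).2)

lemma lt_add_of_pow_le {a m : ℕ} (h : (5 / 6 : ℝ) ^ a ≤ 30 * (5 / 6) ^ m) : m < a + 19 := by
  by_contra! hcon
  have h1 : (5 / 6 : ℝ) ^ m ≤ (5 / 6) ^ (a + 19) :=
    pow_le_pow_of_le_one (by norm_num) (by norm_num) hcon
  have h2 : (0 : ℝ) < (5 / 6) ^ a := by positivity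
  rw [pow_add] at h1
  norm_num at h1
  linarith

lemma level_unique {β R ρ r : ℝ} (hβR : 1 < β * R) (hR : 1 < R) (hr : 0 < r) {m m' : ℕ}
    (h₁ : β * (ρ / R ^ m) ≤ r) (h₂ : r ≤ ρ / R ^ m') : m' ≤ m := by
  by_contra! hcon
  have hR0 : 0 < R := by linarith
  have hρ : 0 < ρ := by
    by_contra! h
    linarith [div_nonpos_of_nonpos_of_nonneg h (pow_pos hR0 m').le]
  have h3 : ρ / R ^ m' ≤ ρ / R ^ (m + 1) :=
    div_le_div_of_nonneg_left hρ.le (by positivity) (pow_le_pow_right₀ hR.le hcon)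
  have h4 : ρ / R ^ (m + 1) * (β * R) = β * (ρ / R ^ m) := by
    field_simp
    ring
  have h5 : 0 < ρ / R ^ (m + 1) := by positivity
  nlinarith

lemma exists_isGoodLine {β δ R θ : ℝ} (hβ : 0 < β) (hδ : δ * 100 ≤ β ^ 2)
    (hR : 1 < R) (hβR : 1 < β * R) (hθ : 0 < θ) (hθR : θ * R ^ 18 ≤ δ * β)
    {F : ℝ → ℕ → ℕ → (ℝ × ℝ) × ℝ → ℝ × ℝ × ℝ}
    (hF : ∀ ρ m k b, 0 < max |(F ρ m k b).1| |(F ρ m k b).2.1|)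
    (B : ℕ → (ℝ × ℝ) × ℝ) (n : ℕ) (hr : 0 < (B n).2) :
    ∃ L, IsLine L ∧ IsGoodLine β δ R θ F B n L := by
  have hR0 : 0 < R := by linarith
  by_cases hm : ∃ m, β * ((B 0).2 / R ^ m) ≤ (B n).2 ∧ (B n).2 ≤ (B 0).2 / R ^ m ∧
      potential R θ F B m (closedBall (B n).1 (B n).2) ≤ 30 * (5 / 6) ^ m
  · obtain ⟨m, hm₁, hm₂, hm₃⟩ := hm
    have hρ : 0 < (B 0).2 := by
      by_contra! h
      linarith [div_nonpos_of_nonpos_of_nonneg h (pow_pos hR0 m).le]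
    obtain ⟨L, hL, hL'⟩ := exists_line_meetWeight_le
      ((Finset.range (m + 1)).sigma fun i => Finset.range (i + 1))
      (w := fun i => (5 / 6 : ℝ) ^ (i.1 + i.2))
      (f := fun i => F (B 0).2 i.1 i.2 (B (levelIndex R B i.1)))
      (γ := fun i => θ * (B 0).2 / R ^ (i.1 + i.2)) (B n).1 hβ hr hδ
      (fun i _ => by positivity) (fun i _ => hF _ _ _ _) (by
        intro i hi hne
        have h1 := (le_meetWeight (w := fun i : (_ : ℕ) × ℕ => (5 / 6 : ℝ) ^ (i.1 + i.2))
          (T := levelStrip R θ F B) (fun i _ => by positivity) hi hne).trans hm₃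
        have h2 : m ≤ i.1 + i.2 + 18 := by
          have := lt_add_of_pow_le h1
          omega
        have h3 : (B 0).2 / R ^ (i.1 + i.2) ≤ R ^ 18 * ((B 0).2 / R ^ m) := by
          rw [← mul_div_assoc, div_le_div_iff₀ (by positivity) (by positivity)]
          have : R ^ m ≤ R ^ (i.1 + i.2 + 18) := pow_le_pow_right₀ hR.le h2
          rw [pow_add] at this
          nlinarith
        calc θ * (B 0).2 / R ^ (i.1 + i.2) = θ * ((B 0).2 / R ^ (i.1 + i.2)) := by ring
          _ ≤ θ * (R ^ 18 * ((B 0).2 / R ^ m)) := by gcongr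
          _ = (θ * R ^ 18) * ((B 0).2 / R ^ m) := by ring
          _ ≤ (δ * β) * ((B 0).2 / R ^ m) := by gcongr
          _ = δ * (β * ((B 0).2 / R ^ m)) := by ring
          _ ≤ δ * (B n).2 := by
            have : 0 < δ * β := lt_of_lt_of_le (by positivity) hθR
            have : 0 < δ := by
              by_contra! h
              nlinarith
            gcongr)
    refine ⟨L, hL, fun m' h₁ h₂ h₃ x r h0 hrδ hsub => ?_⟩
    obtain rfl : m = m' := le_antisymm (level_unique hβR hR hr h₁ hm₂)
      (level_unique hβR hR hr hm₁ h₂)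
    exact hL' x r h0 hrδ hsub
  · push Not at hm
    exact ⟨_, isLine_mk' 0 (u := (1, 0)) (by simp),
      fun m h₁ h₂ h₃ => absurd h₃ (not_le.2 (hm m h₁ h₂))⟩

lemma levelIndex_congr {R : ℝ} (hR : 1 < R) {B B' : ℕ → (ℝ × ℝ) × ℝ} {n m i : ℕ}
    (hB : ∀ j ≤ n, B j = B' j) (h0 : 0 < (B 0).2) (hn : (B n).2 ≤ (B 0).2 / R ^ m) (hi : i ≤ m) :
    levelIndex R B i ≤ n ∧ levelIndex R B i = levelIndex R B' i := by
  have hn' : (B n).2 ≤ (B 0).2 / R ^ i := hn.trans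
    (div_le_div_of_nonneg_left h0.le (by positivity) (pow_le_pow_right₀ hR.le hi))
  have hle : levelIndex R B i ≤ n := Nat.sInf_le hn'
  have hle' : levelIndex R B' i ≤ n := Nat.sInf_le (by
    rw [Set.mem_ofPred_eq, ← hB n le_rfl, ← hB 0 n.zero_le]; exact hn')
  refine ⟨hle, le_antisymm (Nat.sInf_le ?_) (Nat.sInf_le ?_)⟩
  · have : (B' (levelIndex R B' i)).2 ≤ (B' 0).2 / R ^ i :=
      Nat.sInf_mem (s := {n | (B' n).2 ≤ (B' 0).2 / R ^ i})
      ⟨n, by rw [Set.mem_ofPred_eq, ← hB n le_rfl, ← hB 0 n.zero_le]; exact hn'⟩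
    rw [Set.mem_ofPred_eq, hB _ hle', hB 0 n.zero_le]
    exact this
  · have : (B (levelIndex R B i)).2 ≤ (B 0).2 / R ^ i := Nat.sInf_mem (s := {n | (B n).2 ≤ (B 0).2 / R ^ i})
      ⟨n, hn'⟩
    rw [Set.mem_ofPred_eq, ← hB _ hle, ← hB 0 n.zero_le]
    exact this

lemma potential_congr {R θ : ℝ} (hR : 1 < R) {F : ℝ → ℕ → ℕ → (ℝ × ℝ) × ℝ → ℝ × ℝ × ℝ}
    {B B' : ℕ → (ℝ × ℝ) × ℝ} {n m : ℕ} (hB : ∀ j ≤ n, B j = B' j) (h0 : 0 < (B 0).2)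
    (hn : (B n).2 ≤ (B 0).2 / R ^ m) (K : Set (ℝ × ℝ)) :
    potential R θ F B m K = potential R θ F B' m K := by
  unfold potential meetWeight
  refine Finset.sum_congr rfl fun i hi => ?_
  have hi1 : i.1 ≤ m := by
    have := (Finset.mem_sigma.1 hi).1
    rw [Finset.mem_range] at this
    omega
  obtain ⟨hle, heq⟩ := levelIndex_congr hR hB h0 hn hi1
  have : levelStrip R θ F B i = levelStrip R θ F B' i := by
    unfold levelStrip
    rw [← heq, hB _ hle, hB 0 n.zero_le]
  rw [this]

lemma IsGoodLine.congr {β δ R θ : ℝ} (hR : 1 < R) {F : ℝ → ℕ → ℕ → (ℝ × ℝ) × ℝ → ℝ × ℝ × ℝ}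
    {B B' : ℕ → (ℝ × ℝ) × ℝ} {n : ℕ} (hB : ∀ j ≤ n, B j = B' j) (h0 : 0 < (B 0).2)
    {L : AffineSubspace ℝ (ℝ × ℝ)} (h : IsGoodLine β δ R θ F B n L) :
    IsGoodLine β δ R θ F B' n L := by
  intro m h₁ h₂
  rw [← hB n le_rfl, ← hB 0 n.zero_le] at h₁ h₂
  rw [← hB n le_rfl]
  simp only [← potential_congr hR hB h0 h₂]
  exact h m h₁ h₂

/-- The potential grows by at most a controlled amount when a new level is added. -/
lemma potential_succ_le (R θ : ℝ) (F : ℝ → ℕ → ℕ → (ℝ × ℝ) × ℝ → ℝ × ℝ × ℝ)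
    (B : ℕ → (ℝ × ℝ) × ℝ) (m : ℕ) (K : Set (ℝ × ℝ)) :
    potential R θ F B (m + 1) K ≤ potential R θ F B m K + 6 * (5 / 6) ^ (m + 1) := by
  unfold potential meetWeight
  rw [Finset.sum_sigma, Finset.sum_sigma, Finset.sum_range_succ _ (m + 1)]
  gcongr
  calc _ ≤ ∑ k ∈ Finset.range (m + 1 + 1), (5 / 6 : ℝ) ^ (m + 1) * (5 / 6) ^ k := by
        refine Finset.sum_le_sum fun k _ => ?_
        rw [← pow_add]
        split_ifs
        · exact le_rfl
        · positivity
    _ ≤ 6 * (5 / 6) ^ (m + 1) := by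
        rw [← Finset.mul_sum, geom_sum_eq (by norm_num)]
        have : (0 : ℝ) < (5 / 6) ^ (m + 1 + 1) := by positivity
        have h2 : (0 : ℝ) < (5 / 6) ^ (m + 1) := by positivity
        rw [mul_comm]
        gcongr
        rw [div_le_iff_of_neg (by norm_num)]
        linarith

/-- A version of the hyperplane potential game: if avoiding one thin strip for each pair
`k ≤ m`, chosen according to the ball of level `m`, forces a point to lie in `S`, then `S` is
hyperplane absolute winning. -/
theorem isHAWWin_of_strips {β δ R θ : ℝ} (hβ : 0 < β) (hβ1 : β < 1) (hδ : δ * 100 ≤ β ^ 2)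
    (hδ0 : 0 < δ) (hR : 1 ≤ β * δ * R) (hθ : 0 < θ) (hθR : θ * R ^ 18 ≤ δ * β)
    {S : Set (ℝ × ℝ)} {F : ℝ → ℕ → ℕ → (ℝ × ℝ) × ℝ → ℝ × ℝ × ℝ}
    (hF : ∀ ρ m k b, 0 < max |(F ρ m k b).1| |(F ρ m k b).2.1|)
    (hS : ∀ ρ > 0, ∀ (b : ℕ → (ℝ × ℝ) × ℝ) (z : ℝ × ℝ),
      (∀ m, z ∈ closedBall (b m).1 (b m).2 ∧ (b m).2 ≤ ρ / R ^ m) →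
      (∀ m k, k ≤ m → z ∉ affineStrip (F ρ m k (b m)) (θ * ρ / R ^ (m + k))) → z ∈ S) :
    IsHAWWin β S := by
  classical
  have hδ1 : δ < 1 / 100 := by nlinarith
  have hR0 : 0 < R := by
    by_contra! h
    nlinarith [mul_pos hβ hδ0]
  have hβR : 1 < β * R := by nlinarith [mul_pos hβ hR0]
  have hR1 : 1 < R := by nlinarith
  let ext : (n : ℕ) → (Fin (n + 1) → (ℝ × ℝ) × ℝ) → ℕ → (ℝ × ℝ) × ℝ :=
    fun n h j => h ⟨min j n, by omega⟩
  have hext : ∀ (n : ℕ) (h : Fin (n + 1) → (ℝ × ℝ) × ℝ), ext n h n = h (Fin.last n) := by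
    intro n h
    simp only [ext]
    congr 1
    exact Fin.ext (by simp)
  have hex := fun (n : ℕ) (h : Fin (n + 1) → (ℝ × ℝ) × ℝ) (hr : 0 < (h (Fin.last n)).2) =>
    exists_isGoodLine hβ hδ hR1 hβR hθ hθR hF (ext n h) n (by rwa [hext])
  let σ : (n : ℕ) → (Fin (n + 1) → (ℝ × ℝ) × ℝ) → AffineSubspace ℝ (ℝ × ℝ) × ℝ := fun n h =>
    (Classical.epsilon fun L => IsLine L ∧ IsGoodLine β δ R θ F (ext n h) n L,
      β * (h (Fin.last n)).2)
  have hσ := fun n h hr => Classical.epsilon_spec (hex n h hr)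
  refine ⟨σ, fun n h hr => ⟨(hσ n h hr).1, mul_pos hβ hr, le_rfl⟩, fun B hB0 hB => ?_⟩
  by_cases hlim : Tendsto (fun n => (B n).2) atTop (nhds 0)
  swap
  · exact Or.inl hlim
  refine Or.inr fun z hz => ?_
  have hpos : ∀ n, 0 < (B n).2 := by
    intro n
    induction n with
    | zero => exact hB0
    | succ n ih => exact (mul_pos hβ ih).trans_le (hB n).1
  have hanti : Antitone fun n => closedBall (B n).1 (B n).2 :=
    antitone_nat_of_succ_le fun n => fun p hp => ((hB n).2 hp).1
  have hgood : ∀ n, IsGoodLine β δ R θ F B n (σ n fun i => B i.1).1 := by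
    intro n
    refine IsGoodLine.congr hR1 (fun j hj => ?_) ?_ (hσ n (fun i => B i.1) (hpos n)).2
    · simp [ext, min_eq_left hj]
    · simpa [ext] using hB0
  set ν := levelIndex R B with hν
  have hmem : ∀ m, (B (ν m)).2 ≤ (B 0).2 / R ^ m := by
    intro m
    refine Nat.sInf_mem (s := {n | (B n).2 ≤ (B 0).2 / R ^ m}) ?_
    have : 0 < (B 0).2 / R ^ m := by positivity
    exact ((hlim.eventually (gt_mem_nhds this)).exists).imp fun n hn => hn.le
  have hlow : ∀ m, β * ((B 0).2 / R ^ m) ≤ (B (ν m)).2 := by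
    intro m
    have hpow : (B 0).2 / R ^ m ≤ (B 0).2 := div_le_self hB0.le (one_le_pow₀ hR1.le)
    rcases Nat.eq_zero_or_pos (ν m) with h | h
    · rw [h]
      nlinarith [hpow, div_pos hB0 (pow_pos hR0 m)]
    · obtain ⟨j, hj⟩ := Nat.exists_eq_succ_of_ne_zero h.ne'
      have h1 : (B 0).2 / R ^ m < (B j).2 := by
        have := Nat.notMem_of_lt_sInf (s := {n | (B n).2 ≤ (B 0).2 / R ^ m}) (m := j)
          (show j < ν m by omega)
        simpa using this
      have h2 := (hB j).1
      rw [hj]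
      exact (mul_le_mul_of_nonneg_left h1.le hβ.le).trans h2
  have hstep : ∀ m, ν m < ν (m + 1) := by
    intro m
    have hle : ν m ≤ ν (m + 1) := Nat.sInf_le ((hmem (m + 1)).trans
      (div_le_div_of_nonneg_left hB0.le (by positivity)
        (pow_le_pow_right₀ hR1.le m.le_succ)))
    refine lt_of_le_of_ne hle fun heq => ?_
    have := level_unique hβR hR1 (hpos (ν m)) (hlow m) (heq ▸ hmem (m + 1))
    omega
  have hpot : ∀ m, potential R θ F B m (closedBall (B (ν m)).1 (B (ν m)).2)
      ≤ 30 * (5 / 6) ^ m := by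
    intro m
    induction m with
    | zero =>
      refine (meetWeight_le_sum fun i _ => by positivity).trans ?_
      simp [Finset.sum_sigma]
    | succ m ih =>
      have hsub : closedBall (B (ν (m + 1))).1 (B (ν (m + 1))).2 ⊆
          closedBall (B (ν m)).1 (B (ν m)).2 \
            lineNbhd (σ (ν m) fun i => B i.1).1 (β * (B (ν m)).2) :=
        (hanti (hstep m)).trans (hB (ν m)).2
      have hsmall : (B (ν (m + 1))).2 ≤ δ * (B (ν m)).2 := by
        refine (hmem (m + 1)).trans ?_
        have h1 : (B 0).2 / R ^ (m + 1) * (β * R) = β * ((B 0).2 / R ^ m) := by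
          field_simp
          ring
        have h2 : 0 < (B 0).2 / R ^ (m + 1) := by positivity
        have h3 := mul_le_mul_of_nonneg_left (hlow m) hδ0.le
        rw [← h1] at h3
        nlinarith
      have h1 := hgood (ν m) m (hlow m) (hmem m) ih _ _ (hpos _).le hsmall hsub
      have h2 := potential_succ_le R θ F B m (closedBall (B (ν (m + 1))).1 (B (ν (m + 1))).2)
      rw [pow_succ] at h2 ⊢
      linarith
  refine hS _ hB0 (fun m => B (ν m)) z (fun m => ⟨hz _, hmem m⟩) fun m k hkm hcon => ?_
  have h1 := (le_meetWeight (I := (Finset.range (m + k + 19 + 1)).sigma fun i => Finset.range (i + 1))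
    (w := fun i : (_ : ℕ) × ℕ => (5 / 6 : ℝ) ^ (i.1 + i.2)) (i := ⟨m, k⟩)
    (T := levelStrip R θ F B) (fun i _ => by positivity) (by simp; omega)
    ⟨z, hz (ν (m + k + 19)), hcon⟩).trans (hpot (m + k + 19))
  exact absurd (lt_add_of_pow_le h1) (lt_irrefl _)

/-- The point `z` is within the `c`-approximation box of the rational point `(p / q, r / q)`. -/
def IsNear (s t c : ℝ) (p r : ℤ) (q : ℕ) (z : ℝ × ℝ) : Prop :=
  (q : ℝ) ^ s * |q * z.1 - p| ≤ c ∧ (q : ℝ) ^ t * |q * z.2 - r| ≤ c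

lemma mem_badPair_of_forall_not_isNear {s t c : ℝ} (hc : 0 < c) {z : ℝ × ℝ}
    (h : ∀ (p r : ℤ) (q : ℕ), 0 < q → ¬ IsNear s t c p r q z) : z ∈ badPair s t := by
  refine hc.trans_le (le_ciInf fun q => ?_)
  by_contra! hcon
  rw [max_lt_iff] at hcon
  exact h (round ((q : ℕ) * z.1)) (round ((q : ℕ) * z.2)) q q.pos ⟨hcon.1.le, hcon.2.le⟩

/-- Coefficients of a rational line through `(p / q, r / q)` of anisotropically bounded size. -/
structure IsLineThrough (s t : ℝ) (p r : ℤ) (q : ℕ) (A B C : ℤ) : Prop where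
  ne_zero : A ≠ 0 ∨ B ≠ 0
  abs_fst_le : |(A : ℝ)| ≤ (q : ℝ) ^ s
  abs_snd_le : |(B : ℝ)| ≤ (q : ℝ) ^ t
  incidence : A * p + B * r + C * q = 0

lemma exists_isLineThrough {s t : ℝ} (hst : s + t = 1) (p r : ℤ)
    {q : ℕ} (hq : 0 < q) : ∃ A B C, IsLineThrough s t p r q A B C := by
  have hq0 : (0 : ℝ) < q := by exact_mod_cast hq
  set K := ⌊(q : ℝ) ^ s⌋₊
  set J := ⌊(q : ℝ) ^ t⌋₊
  let Z : Finset (ℕ × ℕ) := Finset.range (K + 1) ×ˢ Finset.range (J + 1)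
  have hcard : (Finset.Ico (0 : ℤ) q).card < Z.card := by
    have h1 : (q : ℝ) ^ s < K + 1 := Nat.lt_floor_add_one _
    have h2 : (q : ℝ) ^ t < J + 1 := Nat.lt_floor_add_one _
    have h3 : (q : ℝ) < (K + 1) * (J + 1) := by
      calc (q : ℝ) = (q : ℝ) ^ s * (q : ℝ) ^ t := by
            rw [← Real.rpow_add hq0, hst, Real.rpow_one]
        _ < _ := mul_lt_mul'' h1 h2 (by positivity) (by positivity)
    have h4 : q < (K + 1) * (J + 1) := by exact_mod_cast h3
    simpa [Z] using h4
  obtain ⟨x, hx, y, hy, hne, heq⟩ := Finset.exists_ne_map_eq_of_card_lt_of_maps_to hcard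
    (f := fun x : ℕ × ℕ => ((x.1 : ℤ) * p + x.2 * r) % q) (fun x _ => by
      simp only [Finset.coe_Ico, Set.mem_Ico]
      exact ⟨Int.emod_nonneg _ (by omega), Int.emod_lt_of_pos _ (by omega)⟩)
  obtain ⟨C, hC⟩ := Int.ModEq.dvd (n := q) heq
  simp only [Z, Finset.mem_product, Finset.mem_range] at hx hy
  have hbound : ∀ (w : ℝ) (a b : ℕ), 0 ≤ w → a < ⌊w⌋₊ + 1 → b < ⌊w⌋₊ + 1 →
      |(((a : ℤ) - b : ℤ) : ℝ)| ≤ w := by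
    intro w a b hw ha hb
    have h1 : (a : ℝ) ≤ w := (Nat.cast_le.2 (Nat.lt_succ_iff.1 ha)).trans (Nat.floor_le hw)
    have h2 : (b : ℝ) ≤ w := (Nat.cast_le.2 (Nat.lt_succ_iff.1 hb)).trans (Nat.floor_le hw)
    have h3 : (0 : ℝ) ≤ a := a.cast_nonneg
    have h4 : (0 : ℝ) ≤ b := b.cast_nonneg
    push_cast
    rw [abs_le]
    constructor <;> linarith
  refine ⟨y.1 - x.1, y.2 - x.2, -C, ?_, hbound _ _ _ (by positivity) hy.1 hx.1,
    hbound _ _ _ (by positivity) hy.2 hx.2, ?_⟩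
  · by_contra! hcon
    exact hne (Prod.ext (by omega) (by omega))
  · linear_combination hC

/-- The real coefficient vector of an integral affine function. -/
def castForm (A B C : ℤ) : ℝ × ℝ × ℝ := (A, B, C)

lemma one_le_max_abs {A B : ℤ} (h : A ≠ 0 ∨ B ≠ 0) : 1 ≤ max |(A : ℝ)| |(B : ℝ)| := by
  rcases h with h | h
  · exact le_max_of_le_left (by exact_mod_cast Int.one_le_abs h)
  · exact le_max_of_le_right (by exact_mod_cast Int.one_le_abs h)

lemma abs_mul_affineForm_sub_le {s t c V : ℝ} {A B C p r : ℤ} {q : ℕ} {z : ℝ × ℝ}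
    (hz : IsNear s t c p r q z) (hV : 0 ≤ V) (hA : |(A : ℝ)| ≤ V * (q : ℝ) ^ s)
    (hB : |(B : ℝ)| ≤ V * (q : ℝ) ^ t) :
    |q * affineForm (castForm A B C) z - (A * p + B * r + C * q)| ≤ 2 * V * c := by
  have e : q * affineForm (castForm A B C) z - (A * p + B * r + C * q)
      = A * (q * z.1 - p) + B * (q * z.2 - r) := by
    simp only [affineForm, castForm]; ring
  rw [e]
  refine (abs_add_le _ _).trans ?_
  rw [abs_mul, abs_mul]
  have h1 := mul_le_mul_of_nonneg_right hA (abs_nonneg (q * z.1 - p))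
  have h2 := mul_le_mul_of_nonneg_right hB (abs_nonneg (q * z.2 - r))
  have h3 := mul_le_mul_of_nonneg_left hz.1 hV
  have h4 := mul_le_mul_of_nonneg_left hz.2 hV
  linarith

lemma IsLineThrough.mul_abs_affineForm_le {s t : ℝ} {p r : ℤ} {q : ℕ} {A B C : ℤ}
    (h : IsLineThrough s t p r q A B C) {c : ℝ} {z : ℝ × ℝ}
    (hz : IsNear s t c p r q z) :
    q * |affineForm (castForm A B C) z| ≤ 2 * c := by
  have h1 := abs_mul_affineForm_sub_le (C := C) hz zero_le_one (by simpa using h.abs_fst_le)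
    (by simpa using h.abs_snd_le)
  have h2 : (A * p + B * r + C * q : ℝ) = 0 := by exact_mod_cast h.incidence
  rwa [h2, sub_zero, abs_mul, Nat.abs_cast, mul_one] at h1

/-- Two integral affine functions vanishing at two common rational points are proportional, unless
the points coincide. -/
lemma cross_eq_zero_or_eq {p₁ r₁ p₂ r₂ A₁ B₁ C₁ A₂ B₂ C₂ : ℤ} {q₁ q₂ : ℕ} (hq₁ : 0 < q₁)
    (h₁₁ : A₁ * p₁ + B₁ * r₁ + C₁ * q₁ = 0) (h₁₂ : A₁ * p₂ + B₁ * r₂ + C₁ * q₂ = 0)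
    (h₂₁ : A₂ * p₁ + B₂ * r₁ + C₂ * q₁ = 0) (h₂₂ : A₂ * p₂ + B₂ * r₂ + C₂ * q₂ = 0) :
    (B₁ * C₂ - C₁ * B₂ = 0 ∧ C₁ * A₂ - A₁ * C₂ = 0 ∧ A₁ * B₂ - B₁ * A₂ = 0) ∨
      (p₁ * q₂ = p₂ * q₁ ∧ r₁ * q₂ = r₂ * q₁) := by
  have hq : (q₁ : ℤ) ≠ 0 := by exact_mod_cast hq₁.ne'
  have e1 : (B₁ * C₂ - C₁ * B₂) * q₁ = (A₁ * B₂ - B₁ * A₂) * p₁ := by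
    linear_combination B₁ * h₂₁ - B₂ * h₁₁
  have e2 : (C₁ * A₂ - A₁ * C₂) * q₁ = (A₁ * B₂ - B₁ * A₂) * r₁ := by
    linear_combination A₂ * h₁₁ - A₁ * h₂₁
  have e3 : (B₁ * C₂ - C₁ * B₂) * q₂ = (A₁ * B₂ - B₁ * A₂) * p₂ := by
    linear_combination B₁ * h₂₂ - B₂ * h₁₂
  have e4 : (C₁ * A₂ - A₁ * C₂) * q₂ = (A₁ * B₂ - B₁ * A₂) * r₂ := by
    linear_combination A₂ * h₁₂ - A₁ * h₂₂
  by_cases hD : A₁ * B₂ - B₁ * A₂ = 0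
  · left
    rw [hD, zero_mul] at e1 e2
    exact ⟨(mul_eq_zero.1 e1).resolve_right hq, (mul_eq_zero.1 e2).resolve_right hq, hD⟩
  · right
    constructor
    · apply mul_left_cancel₀ hD
      linear_combination q₁ * e3 - q₂ * e1
    · apply mul_left_cancel₀ hD
      linear_combination q₁ * e4 - q₂ * e2

lemma mem_affineStrip_of_cross_eq_zero {A₁ B₁ C₁ A₂ B₂ C₂ : ℤ} {γ : ℝ} {z : ℝ × ℝ}
    (h₁ : A₁ ≠ 0 ∨ B₁ ≠ 0)
    (h : B₁ * C₂ - C₁ * B₂ = 0 ∧ C₁ * A₂ - A₁ * C₂ = 0 ∧ A₁ * B₂ - B₁ * A₂ = 0)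
    (hz : z ∈ affineStrip (castForm A₁ B₁ C₁) γ) : z ∈ affineStrip (castForm A₂ B₂ C₂) γ := by
  obtain ⟨u1, u2, u3⟩ := h
  have v1 : (B₁ * C₂ - C₁ * B₂ : ℝ) = 0 := by exact_mod_cast u1
  have v2 : (C₁ * A₂ - A₁ * C₂ : ℝ) = 0 := by exact_mod_cast u2
  have v3 : (A₁ * B₂ - B₁ * A₂ : ℝ) = 0 := by exact_mod_cast u3
  have hN := zero_lt_one.trans_le (one_le_max_abs h₁)
  set f₁ := affineForm (castForm A₁ B₁ C₁) z with hf₁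
  set f₂ := affineForm (castForm A₂ B₂ C₂) z with hf₂
  have e1 : A₁ * f₂ = A₂ * f₁ := by
    simp only [hf₁, hf₂, affineForm, castForm]
    linear_combination z.2 * v3 - v2
  have e2 : B₁ * f₂ = B₂ * f₁ := by
    simp only [hf₁, hf₂, affineForm, castForm]
    linear_combination -z.1 * v3 + v1
  have e3 : max |(A₁ : ℝ)| |(B₁ : ℝ)| * |f₂| = max |(A₂ : ℝ)| |(B₂ : ℝ)| * |f₁| := by
    rw [max_mul_of_nonneg _ _ (abs_nonneg _), max_mul_of_nonneg _ _ (abs_nonneg _),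
      ← abs_mul, ← abs_mul, ← abs_mul, ← abs_mul, e1, e2]
  have hz' : |f₁| ≤ γ * max |(A₁ : ℝ)| |(B₁ : ℝ)| := hz
  change |f₂| ≤ γ * max |(A₂ : ℝ)| |(B₂ : ℝ)|
  have h5 : 0 ≤ max |(A₂ : ℝ)| |(B₂ : ℝ)| := by positivity
  have h6 := mul_le_mul_of_nonneg_left hz' h5
  refine le_of_mul_le_mul_left ?_ hN
  rw [e3]
  linarith

lemma abs_combination_le {b₁ b₂ f₁ f₂ β K Q : ℝ} (hQ : 0 < Q) (hb₁ : |b₁| ≤ β) (hb₂ : |b₂| ≤ β)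
    (hf₁ : |f₁| * Q ≤ K) (hf₂ : |f₂| * Q ≤ K) : |b₂ * f₁ - b₁ * f₂| * Q ≤ 2 * β * K := by
  have h0 : 0 ≤ β := (abs_nonneg _).trans hb₁
  have h1 := mul_le_mul hb₂ hf₁ (by positivity) h0
  have h2 := mul_le_mul hb₁ hf₂ (by positivity) h0
  have h3 := mul_le_mul_of_nonneg_right (abs_sub (b₂ * f₁) (b₁ * f₂)) hQ.le
  rw [abs_mul, abs_mul] at h3
  linarith

/-- Cramer's rule estimate: two lines with small coefficients passing near a point meet at
a point whose approximation box contains it. -/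
lemma det_estimate {s t Q η g c a₁ a₂ b₁ b₂ f₁ f₂ : ℝ} (hst : s + t = 1) (ht : 0 ≤ t) (hts : t ≤ s)
    (hQ : 1 ≤ Q) (hη : 0 < η) (hg : 1 ≤ g) (hηg : 4 * g * η ≤ 1) (hc : 0 ≤ c)
    (ha₁ : |a₁| ≤ η ^ 2 * Q ^ s) (ha₂ : |a₂| ≤ η ^ 2 * Q ^ s)
    (hb₁ : |b₁| ≤ Q ^ t) (hb₂ : |b₂| ≤ Q ^ t) (hf₁ : |f₁| * Q ≤ c * g) (hf₂ : |f₂| * Q ≤ c * g) :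
    |a₁ * b₂ - b₁ * a₂| ≤ 2 * η ^ 2 * Q ∧ |a₁ * b₂ - b₁ * a₂| ^ s * |b₂ * f₁ - b₁ * f₂| ≤ c ∧
      |a₁ * b₂ - b₁ * a₂| ^ t * |a₂ * f₁ - a₁ * f₂| ≤ c := by
  have hQ0 : 0 < Q := by linarith
  have hQst : Q ^ s * Q ^ t = Q := by rw [← Real.rpow_add hQ0, hst, Real.rpow_one]
  have hη1 : η ≤ 1 / 4 := by nlinarith
  have hs : 0 ≤ s := ht.trans hts
  have hQs : 0 < Q ^ s := by positivity
  have hQt : 0 < Q ^ t := by positivity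
  have hD : |a₁ * b₂ - b₁ * a₂| ≤ 2 * η ^ 2 * Q := by
    refine (abs_sub _ _).trans ?_
    rw [abs_mul, abs_mul]
    have h1 := mul_le_mul ha₁ hb₂ (abs_nonneg _) (by positivity)
    have h2 := mul_le_mul hb₁ ha₂ (abs_nonneg _) (by positivity)
    calc _ ≤ 2 * η ^ 2 * (Q ^ s * Q ^ t) := by linarith
      _ = _ := by rw [hQst]
  refine ⟨hD, ?_, ?_⟩
  · have h1 := abs_combination_le hQ0 hb₁ hb₂ hf₁ hf₂
    have h2 : |a₁ * b₂ - b₁ * a₂| ^ s ≤ 2 * η * Q ^ s := by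
      calc _ ≤ ((2 * η) ^ (2 : ℝ) * Q) ^ s := by
            refine Real.rpow_le_rpow (abs_nonneg _) (hD.trans ?_) hs
            rw [Real.rpow_two]
            nlinarith [mul_pos (mul_pos hη hη) hQ0]
        _ = (2 * η) ^ (2 * s) * Q ^ s := by
            rw [Real.mul_rpow (by positivity) hQ0.le, ← Real.rpow_mul (by positivity)]
        _ ≤ (2 * η) ^ (1 : ℝ) * Q ^ s := by
            gcongr ?_ * _
            exact Real.rpow_le_rpow_of_exponent_ge (by positivity) (by linarith) (by linarith)
        _ = _ := by rw [Real.rpow_one]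
    refine le_of_mul_le_mul_right ?_ hQ0
    calc |a₁ * b₂ - b₁ * a₂| ^ s * |b₂ * f₁ - b₁ * f₂| * Q
        = |a₁ * b₂ - b₁ * a₂| ^ s * (|b₂ * f₁ - b₁ * f₂| * Q) := by ring
      _ ≤ (2 * η * Q ^ s) * (2 * Q ^ t * (c * g)) := by gcongr
      _ = (4 * g * η) * (c * (Q ^ s * Q ^ t)) := by ring
      _ ≤ 1 * (c * (Q ^ s * Q ^ t)) := by gcongr
      _ = c * Q := by rw [hQst, one_mul]
  · have h1 := abs_combination_le hQ0 ha₁ ha₂ hf₁ hf₂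
    have h2 : |a₁ * b₂ - b₁ * a₂| ^ t ≤ Q ^ t := by
      refine Real.rpow_le_rpow (abs_nonneg _) (hD.trans ?_) ht
      exact mul_le_of_le_one_left hQ0.le (by nlinarith)
    refine le_of_mul_le_mul_right ?_ hQ0
    calc |a₁ * b₂ - b₁ * a₂| ^ t * |a₂ * f₁ - a₁ * f₂| * Q
        = |a₁ * b₂ - b₁ * a₂| ^ t * (|a₂ * f₁ - a₁ * f₂| * Q) := by ring
      _ ≤ Q ^ t * (2 * (η ^ 2 * Q ^ s) * (c * g)) := by gcongr
      _ = (2 * g * η) * η * (c * (Q ^ s * Q ^ t)) := by ring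
      _ ≤ 1 * 1 * (c * (Q ^ s * Q ^ t)) := by
          gcongr
          · nlinarith
          · linarith
      _ = c * Q := by rw [hQst]; ring

/-- Two integral lines with small coefficients that pass close to `z` are either equal or
intersect in a rational point of small denominator close to `z`. -/
lemma cross_eq_zero_or_isNear {s t Q η g c : ℝ} {A₁ B₁ C₁ A₂ B₂ C₂ : ℤ} {z : ℝ × ℝ} (hst : s + t = 1)
    (hs : 0 ≤ s) (ht : 0 ≤ t) (hQ : 1 ≤ Q) (hη : 0 < η) (hg : 1 ≤ g) (hηg : 4 * g * η ≤ 1)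
    (hc : 0 ≤ c) (hc1 : c < 1) (hA₁ : |(A₁ : ℝ)| ≤ Q ^ s) (hA₂ : |(A₂ : ℝ)| ≤ Q ^ s)
    (hB₁ : |(B₁ : ℝ)| ≤ Q ^ t) (hB₂ : |(B₂ : ℝ)| ≤ Q ^ t)
    (hN₁ : max |(A₁ : ℝ)| |(B₁ : ℝ)| ≤ η ^ 2 * Q ^ max s t)
    (hN₂ : max |(A₂ : ℝ)| |(B₂ : ℝ)| ≤ η ^ 2 * Q ^ max s t)
    (hf₁ : |affineForm (castForm A₁ B₁ C₁) z| * Q ≤ c * g)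
    (hf₂ : |affineForm (castForm A₂ B₂ C₂) z| * Q ≤ c * g) :
    (B₁ * C₂ - C₁ * B₂ = 0 ∧ C₁ * A₂ - A₁ * C₂ = 0 ∧ A₁ * B₂ - B₁ * A₂ = 0) ∨
      ∃ (p r : ℤ) (q : ℕ), 0 < q ∧ (q : ℝ) ≤ 2 * η ^ 2 * Q ∧ IsNear s t c p r q z := by
  set f₁ := affineForm (castForm A₁ B₁ C₁) z with hf₁'
  set f₂ := affineForm (castForm A₂ B₂ C₂) z with hf₂'
  have hQ0 : 0 < Q := by linarith
  have hη1 : η ≤ 1 / 4 := by nlinarith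
  have hM : Q ^ max s t ≤ Q := by
    conv_rhs => rw [← Real.rpow_one Q]
    exact Real.rpow_le_rpow_of_exponent_le hQ (max_le (by linarith) (by linarith))
  have e1 : B₂ * f₁ - B₁ * f₂
      = (A₁ * B₂ - B₁ * A₂ : ℤ) * z.1 - (B₁ * C₂ - C₁ * B₂ : ℤ) := by
    simp only [hf₁', hf₂', affineForm, castForm]; push_cast; ring
  have e2 : A₂ * f₁ - A₁ * f₂
      = -((A₁ * B₂ - B₁ * A₂ : ℤ) * z.2 - (C₁ * A₂ - A₁ * C₂ : ℤ)) := by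
    simp only [hf₁', hf₂', affineForm, castForm]; push_cast; ring
  rw [max_le_iff] at hN₁ hN₂
  by_cases hD : A₁ * B₂ - B₁ * A₂ = 0
  · left
    have hsmall : ∀ a₁ a₂ : ℤ, |(a₁ : ℝ)| ≤ η ^ 2 * Q ^ max s t →
        |(a₂ : ℝ)| ≤ η ^ 2 * Q ^ max s t → |a₂ * f₁ - a₁ * f₂| < 1 := by
      intro a₁ a₂ h₁ h₂
      have h3 : η ^ 2 * Q ^ max s t ≤ η ^ 2 * Q := by gcongr
      have h4 := abs_combination_le hQ0 (h₁.trans h3) (h₂.trans h3) hf₁ hf₂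
      have h5 : 2 * (η ^ 2 * Q) * (c * g) = (2 * g * η * η) * c * Q := by ring
      have h6 : 2 * g * η * η ≤ 1 := by nlinarith
      rw [h5] at h4
      have h7 := le_of_mul_le_mul_right h4 hQ0
      nlinarith
    refine ⟨?_, ?_, hD⟩
    · have := hsmall B₁ B₂ hN₁.2 hN₂.2
      rw [e1, hD, Int.cast_zero, zero_mul, zero_sub, abs_neg, ← Int.cast_abs] at this
      exact Int.abs_lt_one_iff.1 (by exact_mod_cast this)
    · have := hsmall A₁ A₂ hN₁.1 hN₂.1
      rw [e2, hD, Int.cast_zero, zero_mul, zero_sub, neg_neg, ← Int.cast_abs] at this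
      exact Int.abs_lt_one_iff.1 (by exact_mod_cast this)
  · right
    have hcomb : |(A₁ * B₂ - B₁ * A₂ : ℝ)| ≤ 2 * η ^ 2 * Q ∧
        |(A₁ * B₂ - B₁ * A₂ : ℝ)| ^ s * |B₂ * f₁ - B₁ * f₂| ≤ c ∧
        |(A₁ * B₂ - B₁ * A₂ : ℝ)| ^ t * |A₂ * f₁ - A₁ * f₂| ≤ c := by
      rcases le_total t s with h | h
      · rw [max_eq_left h] at hN₁ hN₂
        exact det_estimate hst ht h hQ hη hg hηg hc hN₁.1 hN₂.1 hB₁ hB₂ hf₁ hf₂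
      · rw [max_eq_right h] at hN₁ hN₂
        have := det_estimate (by linarith) hs h hQ hη hg hηg hc hN₁.2 hN₂.2 hA₁ hA₂ hf₁ hf₂
        rw [show (A₁ * B₂ - B₁ * A₂ : ℝ) = -(B₁ * A₂ - A₁ * B₂) by ring, abs_neg]
        exact ⟨this.1, this.2.2, this.2.1⟩
    set D := A₁ * B₂ - B₁ * A₂ with hDdef
    have hDr : (A₁ * B₂ - B₁ * A₂ : ℝ) = (D : ℝ) := by push_cast [hDdef]; ring
    have hq : ((D.natAbs : ℕ) : ℝ) = |(D : ℝ)| := by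
      rw [Nat.cast_natAbs, Int.cast_abs]
    rw [hDr, e1, e2, abs_neg, ← hq] at hcomb
    have hsgn : |((D.sign : ℤ) : ℝ)| = 1 := by
      rcases lt_or_gt_of_ne hD with h | h
      · simp [Int.sign_eq_neg_one_of_neg h]
      · simp [Int.sign_eq_one_of_pos h]
    have hmul : ∀ (x : ℝ) (u : ℤ),
        |(D.natAbs : ℝ) * x - (D.sign * u : ℤ)| = |D * x - u| := by
      intro x u
      have h1 : ((D.natAbs : ℕ) : ℝ) = D.sign * D := by
        have : (D.natAbs : ℤ) = D.sign * D := by rw [Int.natCast_natAbs, Int.sign_mul_self_eq_abs]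
        rw [← Int.cast_natCast, this, Int.cast_mul]
      rw [h1, Int.cast_mul, show (D.sign * D * x - D.sign * u : ℝ) = D.sign * (D * x - u) by ring,
        abs_mul, hsgn, one_mul]
    exact ⟨D.sign * (B₁ * C₂ - C₁ * B₂), D.sign * (C₁ * A₂ - A₁ * C₂), D.natAbs,
      Int.natAbs_pos.2 hD, hcomb.1, by rw [hmul]; exact hcomb.2.1, by rw [hmul]; exact hcomb.2.2⟩

/-- The dyadic-type class of a line of height `N` through a rational point of denominator `q`:
`n` records the size of `q * N`, and `k` the size of `N / q ^ M`. -/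
structure InClass (M h R E : ℝ) (n k q : ℕ) (N : ℝ) : Prop where
  le_mul : h * R ^ n ≤ q * N
  mul_lt : q * N < h * R ^ (n + 1)
  lt_height : E / (R ^ 2) ^ (k + 1) * (q : ℝ) ^ M < N
  height_le : k ≠ 0 → N ≤ E / (R ^ 2) ^ k * (q : ℝ) ^ M

lemma exists_inClass {M h R E N : ℝ} {q : ℕ} (hM1 : M ≤ 1) (hR : 1 < R) (hh : 0 < h)
    (hhR : h * R ≤ 1) (hE : 0 < E) (hE1 : E ≤ 1) (hq : 0 < q) (hN : 1 ≤ N) :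
    ∃ m k, k ≤ m ∧ InClass M h R E (m + k) k q N := by
  have hq1 : (1 : ℝ) ≤ q := by exact_mod_cast hq
  have hR0 : 0 < R := by linarith
  have hR2 : 1 < R ^ 2 := by nlinarith
  have hqM : (q : ℝ) ^ M ≤ q := by
    conv_rhs => rw [← Real.rpow_one (q : ℝ)]
    exact Real.rpow_le_rpow_of_exponent_le hq1 hM1
  have hh1 : h ≤ 1 := by nlinarith
  have hqN : (q : ℝ) ≤ q * N := by nlinarith
  obtain ⟨n, hn₁, hn₂⟩ := exists_nat_pow_near (x := q * N / h)
    (by rw [le_div_iff₀ hh]; linarith) hR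
  rw [le_div_iff₀ hh, mul_comm] at hn₁
  rw [div_lt_iff₀ hh, mul_comm _ h] at hn₂
  rcases lt_or_ge (E * (q : ℝ) ^ M) N with hlt | hge
  · refine ⟨n, 0, n.zero_le, hn₁, hn₂, lt_of_le_of_lt ?_ hlt, fun h => absurd rfl h⟩
    gcongr
    exact div_le_self hE.le (one_le_pow₀ hR2.le)
  · obtain ⟨k, hk₁, hk₂⟩ := exists_nat_pow_near (x := E * (q : ℝ) ^ M / N)
      (by rw [le_div_iff₀ (by linarith)]; linarith) hR2
    rw [le_div_iff₀ (by linarith)] at hk₁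
    rw [div_lt_iff₀ (by linarith)] at hk₂
    have hkn : 2 * k ≤ n := by
      by_contra! hcon
      have h1 : R ^ (n + 1) ≤ R ^ (2 * k) := pow_le_pow_right₀ hR.le hcon
      rw [pow_mul] at h1
      have h2 : (R ^ 2) ^ k ≤ q := by
        have : (R ^ 2) ^ k ≤ (R ^ 2) ^ k * N := le_mul_of_one_le_right (by positivity) hN
        have : E * (q : ℝ) ^ M ≤ 1 * q := by gcongr
        linarith
      have h3 : h * R ^ (n + 1) ≤ 1 * R ^ (n + 1) := by gcongr
      linarith
    obtain ⟨m, rfl⟩ : ∃ m, n = m + k := ⟨n - k, by omega⟩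
    refine ⟨m, k, by omega, hn₁, hn₂, ?_, fun _ => ?_⟩
    · rw [div_mul_eq_mul_div, div_lt_iff₀ (by positivity)]
      linarith
    · rw [div_mul_eq_mul_div, le_div_iff₀ (by positivity)]
      linarith

/-- Denominators in the same class are comparable. -/
lemma InClass.le_mul_denom {M h R E U V N₁ N₂ : ℝ} {n k q₁ q₂ : ℕ} (hM : 0 ≤ M) (hR : 0 < R)
    (hE : 0 < E) (hq₁ : 0 < q₁) (hq₂ : 0 < q₂) (h₁ : InClass M h R E n k q₁ N₁)
    (h₂ : InClass M h R E n k q₂ N₂) (hU : N₂ ≤ U * (q₂ : ℝ) ^ M) (hV1 : 1 ≤ V)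
    (hV : R * U * ((R ^ 2) ^ (k + 1) / E) ≤ V) : (q₁ : ℝ) ≤ V * q₂ := by
  have hq₁0 : (0 : ℝ) < q₁ := by exact_mod_cast hq₁
  have hq₂0 : (0 : ℝ) < q₂ := by exact_mod_cast hq₂
  by_contra! hcon
  have h3 : (q₂ : ℝ) ^ M ≤ (q₁ : ℝ) ^ M :=
    Real.rpow_le_rpow hq₂0.le (by nlinarith) hM
  have h4 : E / (R ^ 2) ^ (k + 1) * ((q₁ : ℝ) ^ M * q₁) < R * U * ((q₂ : ℝ) ^ M * q₂) := by
    calc _ = q₁ * (E / (R ^ 2) ^ (k + 1) * (q₁ : ℝ) ^ M) := by ring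
      _ < q₁ * N₁ := by gcongr; exact h₁.lt_height
      _ < h * R ^ (n + 1) := h₁.mul_lt
      _ = R * (h * R ^ n) := by ring
      _ ≤ R * (q₂ * N₂) := mul_le_mul_of_nonneg_left h₂.le_mul hR.le
      _ ≤ R * (q₂ * (U * (q₂ : ℝ) ^ M)) := by gcongr
      _ = _ := by ring
  have h5 : (q₁ : ℝ) ^ M * q₁ < V * ((q₂ : ℝ) ^ M * q₂) := by
    have e : (q₁ : ℝ) ^ M * q₁ = (R ^ 2) ^ (k + 1) / E *
        (E / (R ^ 2) ^ (k + 1) * ((q₁ : ℝ) ^ M * q₁)) := by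
      field_simp
    calc _ = _ := e
      _ < (R ^ 2) ^ (k + 1) / E * (R * U * ((q₂ : ℝ) ^ M * q₂)) := by gcongr
      _ = R * U * ((R ^ 2) ^ (k + 1) / E) * ((q₂ : ℝ) ^ M * q₂) := by ring
      _ ≤ _ := by gcongr
  have h6 : V * ((q₂ : ℝ) ^ M * q₂) ≤ (q₁ : ℝ) ^ M * q₁ := by
    calc _ = (q₂ : ℝ) ^ M * (V * q₂) := by ring
      _ ≤ _ := by gcongr
  linarith

/-- A line through a rational point near `w` stays small at distance of order `ρ / R ^ m`. -/
lemma IsLineThrough.mul_abs_affineForm_le_of_dist {s t M c h R E θ ρ G : ℝ} {m k : ℕ} {p r : ℤ}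
    {q : ℕ} {A B C : ℤ} {z w : ℝ × ℝ} (hL : IsLineThrough s t p r q A B C) (hc : 0 ≤ c) (hR : 1 ≤ R)
    (hρ : 0 < ρ) (hθ : 0 < θ) (hh : h * (θ * ρ) = 2 * c) (hG : 2 + 8 * R / θ ≤ G)
    (hcl : InClass M h R E (m + k) k q (max |(A : ℝ)| |(B : ℝ)|))
    (hw : IsNear s t c p r q w) (hzw : dist z w ≤ 2 * (ρ / R ^ m)) :
    q * |affineForm (castForm A B C) z| ≤ c * (G * R ^ k) := by
  have h1 := hL.mul_abs_affineForm_le hw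
  have h2 : |affineForm (castForm A B C) z - affineForm (castForm A B C) w|
    ≤ 2 * (2 * (ρ / R ^ m)) * max |(A : ℝ)| |(B : ℝ)| := abs_affineForm_sub_le _ hzw
  have h3 : |affineForm (castForm A B C) z| ≤ |affineForm (castForm A B C) w| +
      2 * (2 * (ρ / R ^ m)) * max |(A : ℝ)| |(B : ℝ)| := by
    linarith [abs_sub_abs_le_abs_sub (affineForm (castForm A B C) z)
      (affineForm (castForm A B C) w)]
  have hh' : h * ρ = 2 * c / θ := by
    rw [eq_div_iff hθ.ne']; linarith
  have hR0 : 0 < R := by linarith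
  calc q * |affineForm (castForm A B C) z|
      ≤ q * (|affineForm (castForm A B C) w| +
        2 * (2 * (ρ / R ^ m)) * max |(A : ℝ)| |(B : ℝ)|) := by gcongr
    _ = q * |affineForm (castForm A B C) w| +
        4 * (ρ / R ^ m) * (q * max |(A : ℝ)| |(B : ℝ)|) := by ring
    _ ≤ 2 * c + 4 * (ρ / R ^ m) * (h * R ^ (m + k + 1)) := 
        add_le_add h1 (mul_le_mul_of_nonneg_left hcl.mul_lt.le (by positivity))
    _ = 2 * c + 4 * (h * ρ) * R * R ^ k := by
        rw [pow_add, pow_add]; field_simp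
    _ = 2 * c * 1 + c * (8 * R / θ * R ^ k) := by rw [hh']; ring
    _ ≤ 2 * c * R ^ k + c * (8 * R / θ * R ^ k) := by
        gcongr
        exact one_le_pow₀ hR
    _ = c * ((2 + 8 * R / θ) * R ^ k) := by ring
    _ ≤ _ := by gcongr

/-- If an integral affine function is small enough near a rational point, it vanishes there. -/
lemma incidence_of_small {s t c V K : ℝ} {A B C p r : ℤ} {q q' : ℕ} {z : ℝ × ℝ} (hs : 0 ≤ s)
    (hs1 : s ≤ 1) (ht : 0 ≤ t) (ht1 : t ≤ 1) (hV : 1 ≤ V) (hA : |(A : ℝ)| ≤ (q : ℝ) ^ s)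
    (hB : |(B : ℝ)| ≤ (q : ℝ) ^ t) (hqq' : (q : ℝ) ≤ V * q') (hq'q : (q' : ℝ) ≤ V * q)
    (hz : IsNear s t c p r q' z) (hf : q * |affineForm (castForm A B C) z| ≤ c * K)
    (hsmall : c * V * (K + 2) < 1) : A * p + B * r + C * q' = 0 := by
  have hpow : ∀ u : ℝ, 0 ≤ u → u ≤ 1 → (q : ℝ) ^ u ≤ V * (q' : ℝ) ^ u := by
    intro u hu hu1
    calc (q : ℝ) ^ u ≤ (V * q') ^ u := Real.rpow_le_rpow (by positivity) hqq' hu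
      _ = V ^ u * (q' : ℝ) ^ u := Real.mul_rpow (by linarith) (by positivity)
      _ ≤ V ^ (1 : ℝ) * (q' : ℝ) ^ u := by
          gcongr ?_ * _
          exact Real.rpow_le_rpow_of_exponent_le hV hu1
      _ = _ := by rw [Real.rpow_one]
  have h1 := abs_mul_affineForm_sub_le (C := C) hz (by linarith) (hA.trans (hpow s hs hs1))
    (hB.trans (hpow t ht ht1))
  have h2 : |q' * affineForm (castForm A B C) z| ≤ V * (c * K) := by
    rw [abs_mul, Nat.abs_cast]
    calc q' * |affineForm (castForm A B C) z| ≤ V * q * |affineForm (castForm A B C) z| := by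
          gcongr
      _ = V * (q * |affineForm (castForm A B C) z|) := by ring
      _ ≤ _ := by gcongr
  have h3 : |(A * p + B * r + C * q' : ℝ)| < 1 := by
    have := abs_sub_abs_le_abs_sub (A * p + B * r + C * q' : ℝ)
      (q' * affineForm (castForm A B C) z)
    rw [abs_sub_comm] at this
    linarith
  have h4 : |A * p + B * r + C * q'| < 1 := by exact_mod_cast h3
  exact Int.abs_lt_one_iff.1 h4

/-- Lines in the same class passing through rational points near two close
points agree, unless one of the points is near a rational point of smaller denominator. -/
lemma cross_eq_zero_or_eq_or_isNear {s t c h R E θ ρ G η : ℝ} {m k : ℕ} {p₁ r₁ p₂ r₂ : ℤ}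
    {q₁ q₂ : ℕ} {A₁ B₁ C₁ A₂ B₂ C₂ : ℤ} {z z' : ℝ × ℝ} (hs : 0 ≤ s) (ht : 0 ≤ t) (hst : s + t = 1)
    (hR : 1 < R) (hθ : 0 < θ) (hρ : 0 < ρ) (hG : 2 + 8 * R / θ ≤ G) (hη : 0 < η)
    (hηG : 4 * (G * R ^ 3) * η ≤ 1) (hE : E = η ^ 2) (hc : 0 < c) (hc1 : c < 1)
    (hh : h * (θ * ρ) = 2 * c) (hcV : c * (R ^ 3 / E) * (G + 2) < 1) (hq₁ : 0 < q₁) (hq₂ : 0 < q₂)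
    (hL₁ : IsLineThrough s t p₁ r₁ q₁ A₁ B₁ C₁) (hL₂ : IsLineThrough s t p₂ r₂ q₂ A₂ B₂ C₂)
    (hcl₁ : InClass (max s t) h R E (m + k) k q₁ (max |(A₁ : ℝ)| |(B₁ : ℝ)|))
    (hcl₂ : InClass (max s t) h R E (m + k) k q₂ (max |(A₂ : ℝ)| |(B₂ : ℝ)|))
    (hz : IsNear s t c p₁ r₁ q₁ z) (hz' : IsNear s t c p₂ r₂ q₂ z')
    (hzz' : dist z z' ≤ 2 * (ρ / R ^ m)) :
    (B₁ * C₂ - C₁ * B₂ = 0 ∧ C₁ * A₂ - A₁ * C₂ = 0 ∧ A₁ * B₂ - B₁ * A₂ = 0) ∨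
      (p₁ * q₂ = p₂ * q₁ ∧ r₁ * q₂ = r₂ * q₁) ∨
      ∃ (p r : ℤ) (q : ℕ), 0 < q ∧ q < q₁ ∧ IsNear s t c p r q z := by
  have hR0 : 0 < R := by linarith
  have hR3 : 1 ≤ R ^ 3 := one_le_pow₀ hR.le
  have hG2 : 2 ≤ G := by
    have : 0 < 8 * R / θ := by positivity
    linarith
  have hη1 : η ≤ 1 / 8 := by nlinarith [mul_le_mul hG2 hR3 zero_le_one (by linarith)]
  have hE0 : 0 < E := by rw [hE]; positivity
  have hE1 : E ≤ 1 := by rw [hE]; nlinarith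
  have hM : 0 ≤ max s t := le_max_of_le_left hs
  have hq₁1 : (1 : ℝ) ≤ q₁ := by exact_mod_cast hq₁
  have hq₂1 : (1 : ℝ) ≤ q₂ := by exact_mod_cast hq₂
  have hself : ∀ w : ℝ × ℝ, dist w w ≤ 2 * (ρ / R ^ m) := fun w => by
    rw [dist_self]; positivity
  rcases Nat.eq_zero_or_pos k with rfl | hk
  · have hbound : ∀ {p r : ℤ} {q : ℕ} {A B C : ℤ}, 0 < q → IsLineThrough s t p r q A B C →
        max |(A : ℝ)| |(B : ℝ)| ≤ 1 * (q : ℝ) ^ max s t := by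
      intro p r q A B C hq hL
      have hq1 : (1 : ℝ) ≤ q := by exact_mod_cast hq
      rw [one_mul]
      exact max_le
        (hL.abs_fst_le.trans (Real.rpow_le_rpow_of_exponent_le hq1 (le_max_left _ _)))
        (hL.abs_snd_le.trans (Real.rpow_le_rpow_of_exponent_le hq1 (le_max_right _ _)))
    have hV1 : 1 ≤ R ^ 3 / E := by
      rw [le_div_iff₀ hE0]; linarith
    have hV : R * 1 * ((R ^ 2) ^ (0 + 1) / E) ≤ R ^ 3 / E := by
      apply le_of_eq; ring
    have h12 := hcl₁.le_mul_denom hM hR0 hE0 hq₁ hq₂ hcl₂ (hbound hq₂ hL₂) hV1 hV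
    have h21 := hcl₂.le_mul_denom hM hR0 hE0 hq₂ hq₁ hcl₁ (hbound hq₁ hL₁) hV1 hV
    have hf₁ := hL₁.mul_abs_affineForm_le_of_dist (z := z') hc.le hR.le hρ hθ hh hG hcl₁ hz
      (by rwa [dist_comm])
    have hf₂ := hL₂.mul_abs_affineForm_le_of_dist (z := z) hc.le hR.le hρ hθ hh hG hcl₂ hz' hzz'
    rw [pow_zero, mul_one] at hf₁ hf₂
    have h₁₂ := incidence_of_small hs (by linarith) ht (by linarith) hV1 hL₁.abs_fst_le
      hL₁.abs_snd_le h12 h21 hz' hf₁ hcV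
    have h₂₁ := incidence_of_small hs (by linarith) ht (by linarith) hV1 hL₂.abs_fst_le
      hL₂.abs_snd_le h21 h12 hz hf₂ hcV
    rcases cross_eq_zero_or_eq hq₁ hL₁.incidence h₁₂ h₂₁ hL₂.incidence with h | h
    · exact Or.inl h
    · exact Or.inr (Or.inl h)
  · have hV : R * (E / (R ^ 2) ^ k) * ((R ^ 2) ^ (k + 1) / E) ≤ R ^ 3 := by
      apply le_of_eq; field_simp; ring
    have h12 := hcl₁.le_mul_denom hM hR0 hE0 hq₁ hq₂ hcl₂ (hcl₂.height_le hk.ne') hR3 hV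
    have h21 := hcl₂.le_mul_denom hM hR0 hE0 hq₂ hq₁ hcl₁ (hcl₁.height_le hk.ne') hR3 hV
    set Q : ℝ := max q₁ q₂ with hQ
    have hQ1 : 1 ≤ Q := le_max_of_le_left hq₁1
    have hQq₁ : Q ≤ R ^ 3 * q₁ := max_le (by nlinarith) h21
    have hQq₂ : Q ≤ R ^ 3 * q₂ := max_le h12 (by nlinarith)
    have hf₁ := hL₁.mul_abs_affineForm_le_of_dist (z := z) hc.le hR.le hρ hθ hh hG hcl₁ hz
      (hself z)
    have hf₂ := hL₂.mul_abs_affineForm_le_of_dist (z := z) hc.le hR.le hρ hθ hh hG hcl₂ hz' hzz'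
    have hscale : ∀ {q : ℕ} {x : ℝ}, Q ≤ R ^ 3 * q → q * |x| ≤ c * (G * R ^ k) →
        |x| * Q ≤ c * (G * R ^ 3 * R ^ k) := by
      intro q x h1 h2
      calc |x| * Q ≤ |x| * (R ^ 3 * q) := by gcongr
        _ = R ^ 3 * (q * |x|) := by ring
        _ ≤ R ^ 3 * (c * (G * R ^ k)) := by gcongr
        _ = _ := by ring
    have hRk : 1 ≤ R ^ k := one_le_pow₀ hR.le
    have hξ : E / (R ^ 2) ^ k = (η / R ^ k) ^ 2 := by
      rw [hE, div_pow, ← pow_mul, ← pow_mul, mul_comm]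
    have hmono : ∀ {q : ℕ} {u : ℝ}, (q : ℝ) ≤ Q → 0 ≤ u → (q : ℝ) ^ u ≤ Q ^ u :=
      fun h hu => Real.rpow_le_rpow (Nat.cast_nonneg _) h hu
    have hq₁Q : (q₁ : ℝ) ≤ Q := le_max_left _ _
    have hq₂Q : (q₂ : ℝ) ≤ Q := le_max_right _ _
    have hgη : 4 * (G * R ^ 3 * R ^ k) * (η / R ^ k) ≤ 1 := by
      calc _ = 4 * (G * R ^ 3) * η := by field_simp
        _ ≤ 1 := hηG
    have hg : 1 ≤ G * R ^ 3 * R ^ k :=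
      one_le_mul_of_one_le_of_one_le (one_le_mul_of_one_le_of_one_le (by linarith) hR3) hRk
    rcases cross_eq_zero_or_isNear hst hs ht hQ1 (by positivity) hg hgη hc.le hc1
      (hL₁.abs_fst_le.trans (hmono hq₁Q hs)) (hL₂.abs_fst_le.trans (hmono hq₂Q hs))
      (hL₁.abs_snd_le.trans (hmono hq₁Q ht)) (hL₂.abs_snd_le.trans (hmono hq₂Q ht))
      ((hcl₁.height_le hk.ne').trans (by rw [hξ]; gcongr))
      ((hcl₂.height_le hk.ne').trans (by rw [hξ]; gcongr))
      (hscale hQq₁ hf₁) (hscale hQq₂ hf₂) with h | ⟨p, r, q, hq, hqQ, hnear⟩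
    · exact Or.inl h
    · refine Or.inr (Or.inr ⟨p, r, q, hq, ?_, hnear⟩)
      have h1 : η / R ^ k ≤ η := div_le_self hη.le hRk
      have h2 : (η / R ^ k) ^ 2 ≤ η * (1 / 8) := by
        rw [sq]
        exact mul_le_mul h1 (h1.trans hη1) (by positivity) hη.le
      have h3 : η * R ^ 3 ≤ 1 / 8 := by nlinarith [mul_pos hη (pow_pos hR0 3)]
      have h4 : (q : ℝ) < q₁ := by
        calc (q : ℝ) ≤ 2 * (η / R ^ k) ^ 2 * Q := hqQ
          _ ≤ 2 * (η * (1 / 8)) * (R ^ 3 * q₁) := by gcongr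
          _ = 1 / 4 * (η * R ^ 3) * q₁ := by ring
          _ ≤ 1 / 4 * (1 / 8) * q₁ := by gcongr
          _ < q₁ := by linarith
      exact_mod_cast h4

/-- A representation of a rational point with least positive denominator. -/
def IsPrimitiveRep (p r : ℤ) (q : ℕ) : Prop :=
  ∀ (p' r' : ℤ) (q' : ℕ), 0 < q' → p' * q = p * q' → r' * q = r * q' → q ≤ q'

lemma IsNear.of_eq_of_le {s t c : ℝ} {p r p' r' : ℤ} {q q' : ℕ} {z : ℝ × ℝ} (hs : 0 ≤ s)
    (ht : 0 ≤ t) (hq : 0 < q) (hq' : q' ≤ q) (hp : p' * q = p * q') (hr : r' * q = r * q')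
    (hz : IsNear s t c p r q z) : IsNear s t c p' r' q' z := by
  have hq0 : (0 : ℝ) < q := by exact_mod_cast hq
  have hle : (q' : ℝ) ≤ q := by exact_mod_cast hq'
  have key : ∀ {u x : ℝ} {a a' : ℤ}, 0 ≤ u → a' * q = a * q' → (q : ℝ) ^ u * |q * x - a| ≤ c →
      (q' : ℝ) ^ u * |q' * x - a'| ≤ c := by
    intro u x a a' hu ha h
    have ha' : (a' : ℝ) * q = a * q' := by exact_mod_cast ha
    have e : q * |q' * x - a'| = q' * |q * x - a| := by
      rw [← Nat.abs_cast (R := ℝ) q, ← abs_mul, ← Nat.abs_cast (R := ℝ) q', ← abs_mul,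
        Nat.abs_cast, Nat.abs_cast]
      congr 1
      linear_combination -ha'
    have h1 : |q' * x - a'| ≤ |q * x - a| := by
      refine le_of_mul_le_mul_left ?_ hq0
      rw [e]
      gcongr
    refine le_trans ?_ h
    gcongr
  exact ⟨key hs hp hz.1, key ht hr hz.2⟩

/-- At each scale and for each ball there is a single line whose neighbourhood has to be avoided
in order to reach a badly approximable point. -/
theorem exists_strips {s t R θ ρ : ℝ} (hs : 0 ≤ s) (ht : 0 ≤ t) (hst : s + t = 1) (hR : 1 < R)
    (hθ : 0 < θ) (hρ : 0 < ρ) :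
    ∃ F : ℕ → ℕ → (ℝ × ℝ) × ℝ → ℝ × ℝ × ℝ,
      (∀ m k b, 0 < max |(F m k b).1| |(F m k b).2.1|) ∧
      ∀ (b : ℕ → (ℝ × ℝ) × ℝ) (z : ℝ × ℝ),
        (∀ m, z ∈ closedBall (b m).1 (b m).2 ∧ (b m).2 ≤ ρ / R ^ m) →
        (∀ m k, k ≤ m → z ∉ affineStrip (F m k (b m)) (θ * ρ / R ^ (m + k))) →
        z ∈ badPair s t := by
  obtain ⟨G, hG⟩ : ∃ G, G = 2 + 8 * R / θ := ⟨_, rfl⟩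
  have hR0 : 0 < R := by linarith
  have hG2 : 2 ≤ G := by
    have : 0 < 8 * R / θ := by positivity
    linarith
  have hG0 : 0 < G := by linarith
  obtain ⟨η, hη⟩ : ∃ η, η = 1 / (4 * (G * R ^ 3)) := ⟨_, rfl⟩
  have hη0 : 0 < η := by rw [hη]; positivity
  have hηG : 4 * (G * R ^ 3) * η ≤ 1 := by
    apply le_of_eq
    rw [hη]
    field_simp
  have hη1 : η ≤ 1 := by
    nlinarith [mul_le_mul hG2 (one_le_pow₀ (n := 3) hR.le) zero_le_one (by linarith)]
  have hE0 : 0 < η ^ 2 := by positivity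
  obtain ⟨V, hV⟩ : ∃ V, V = R ^ 3 / η ^ 2 * (G + 2) := ⟨_, rfl⟩
  have hV0 : 0 < V := by rw [hV]; positivity
  obtain ⟨c, hc⟩ : ∃ c, c = min (1 / 2) (min (θ * ρ / (2 * R)) (1 / (2 * V))) := ⟨_, rfl⟩
  have hc0 : 0 < c := by rw [hc]; positivity
  have hc1 : c < 1 := by
    have : c ≤ 1 / 2 := by rw [hc]; exact min_le_left _ _
    linarith
  have hcR : c ≤ θ * ρ / (2 * R) := by
    rw [hc]; exact (min_le_right _ _).trans (min_le_left _ _)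
  have hcV : c * (R ^ 3 / η ^ 2) * (G + 2) < 1 := by
    have h1 : c ≤ 1 / (2 * V) := by rw [hc]; exact (min_le_right _ _).trans (min_le_right _ _)
    rw [le_div_iff₀ (by positivity)] at h1
    rw [mul_assoc, ← hV]
    linarith
  obtain ⟨h, hh⟩ : ∃ h, h = 2 * c / (θ * ρ) := ⟨_, rfl⟩
  have hh0 : 0 < h := by rw [hh]; positivity
  have hhc : h * (θ * ρ) = 2 * c := by rw [hh]; field_simp
  have hhR : h * R ≤ 1 := by
    rw [le_div_iff₀ (by positivity)] at hcR
    rw [hh, div_mul_eq_mul_div, div_le_one (by positivity)]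
    linarith
  have hM1 : max s t ≤ 1 := max_le (by linarith) (by linarith)
  have hex : ∀ (p r : ℤ) (q : ℕ), ∃ A B C, 0 < q → IsLineThrough s t p r q A B C := by
    intro p r q
    rcases Nat.eq_zero_or_pos q with rfl | hq
    · exact ⟨0, 0, 0, fun h => absurd h (lt_irrefl _)⟩
    · obtain ⟨A, B, C, hL⟩ := exists_isLineThrough hst p r hq
      exact ⟨A, B, C, fun _ => hL⟩
  choose A B C hL using hex
  let P : ℕ → ℕ → (ℝ × ℝ) × ℝ → ℤ → ℤ → ℕ → Prop := fun m k b p r q =>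
    0 < q ∧ IsPrimitiveRep p r q ∧
      InClass (max s t) h R (η ^ 2) (m + k) k q (max |(A p r q : ℝ)| |(B p r q : ℝ)|) ∧
      ∃ z ∈ closedBall b.1 b.2, IsNear s t c p r q z
  have hF : ∀ m k b, ∃ f : ℝ × ℝ × ℝ, 0 < max |f.1| |f.2.1| ∧ ((∃ p r q, P m k b p r q) →
      ∃ p r q, P m k b p r q ∧ f = castForm (A p r q) (B p r q) (C p r q)) := by
    intro m k b
    by_cases hP : ∃ p r q, P m k b p r q
    · obtain ⟨p, r, q, hq⟩ := hP
      exact ⟨castForm (A p r q) (B p r q) (C p r q),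
        zero_lt_one.trans_le (one_le_max_abs (hL p r q hq.1).ne_zero),
        fun _ => ⟨p, r, q, hq, rfl⟩⟩
    · exact ⟨(1, 0, 0), by simp, fun h => absurd h hP⟩
  choose F hF0 hF1 using hF
  refine ⟨F, hF0, fun b z hb hz => mem_badPair_of_forall_not_isNear hc0 fun p r q => ?_⟩
  induction q using Nat.strong_induction_on generalizing p r with
  | _ q ih =>
    intro hq hnear
    have hprim : IsPrimitiveRep p r q := by
      intro p' r' q' hq' hp hr
      by_contra! hlt
      exact ih q' hlt p' r' hq' (hnear.of_eq_of_le hs ht hq hlt.le hp hr)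
    have hL₁ := hL p r q hq
    obtain ⟨m, k, hkm, hcl⟩ := exists_inClass hM1 hR hh0 hhR hE0
      (pow_le_one₀ hη0.le hη1) hq (one_le_max_abs hL₁.ne_zero)
    obtain ⟨p₂, r₂, q₂, ⟨hq₂, hprim₂, hcl₂, w, hw, hnear₂⟩, hFeq⟩ := hF1 m k (b m)
      ⟨p, r, q, hq, hprim, hcl, z, (hb m).1, hnear⟩
    have hstrip : z ∈ affineStrip (castForm (A p r q) (B p r q) (C p r q))
        (θ * ρ / R ^ (m + k)) := by
      have hq0 : (0 : ℝ) < q := by exact_mod_cast hq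
      change |affineForm (castForm (A p r q) (B p r q) (C p r q)) z| ≤
        θ * ρ / R ^ (m + k) * max |(A p r q : ℝ)| |(B p r q : ℝ)|
      refine le_of_mul_le_mul_left ?_ hq0
      calc _ ≤ 2 * c := hL₁.mul_abs_affineForm_le hnear
        _ = θ * ρ / R ^ (m + k) * (h * R ^ (m + k)) := by rw [← hhc]; field_simp
        _ ≤ θ * ρ / R ^ (m + k) * (q * max |(A p r q : ℝ)| |(B p r q : ℝ)|) :=
          mul_le_mul_of_nonneg_left hcl.le_mul (by positivity)
        _ = _ := by ring
    have hdist : dist z w ≤ 2 * (ρ / R ^ m) := by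
      have h1 := dist_triangle_right z w (b m).1
      have h2 := mem_closedBall.1 (hb m).1
      have h3 := mem_closedBall.1 hw
      linarith [(hb m).2]
    have havoid := hz m k hkm
    rw [hFeq] at havoid
    rcases cross_eq_zero_or_eq_or_isNear hs ht hst hR hθ hρ hG.ge hη0 hηG rfl hc0 hc1 hhc hcV
      hq hq₂ hL₁ (hL p₂ r₂ q₂ hq₂) hcl hcl₂ hnear hnear₂ hdist with
      hcross | ⟨hp, hr⟩ | ⟨p', r', q', hq', hlt, hnear'⟩
    · exact havoid (mem_affineStrip_of_cross_eq_zero hL₁.ne_zero hcross hstrip)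
    · obtain rfl : q = q₂ :=
        le_antisymm (hprim p₂ r₂ q₂ hq₂ hp.symm hr.symm) (hprim₂ p r q hq hp hr)
      have hqz : (q : ℤ) ≠ 0 := by exact_mod_cast hq.ne'
      obtain rfl := mul_right_cancel₀ hqz hp
      obtain rfl := mul_right_cancel₀ hqz hr
      exact havoid hstrip
    · exact ih q' hlt p' r' hq' hnear'

/-- **Bad(s,t) is hyperplane absolute winning**: for all `s, t ≥ 0` with `s + t = 1` and every
`0 < β < 1/3`, Alice has a winning strategy for the `β`-hyperplane absolute game on ℝ² with
target set `Bad(s,t)`. -/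
theorem badPair_hyperplane_absolute_winning (s t : ℝ) (hs : 0 ≤ s) (ht : 0 ≤ t)
    (hst : s + t = 1) (β : ℝ) (hβ0 : 0 < β) (hβ : β < 1 / 3) :
    IsHAWWin β (badPair s t) := by
  obtain ⟨δ, hδ⟩ : ∃ δ, δ = β ^ 2 / 100 := ⟨_, rfl⟩
  have hδ0 : 0 < δ := by rw [hδ]; positivity
  obtain ⟨R, hR⟩ : ∃ R, R = 1 / (β * δ) := ⟨_, rfl⟩
  have hR1 : 1 < R := by
    rw [hR, lt_div_iff₀ (by positivity), hδ]
    nlinarith [mul_pos hβ0 hβ0]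
  have hR0 : 0 < R := by linarith
  obtain ⟨θ, hθ⟩ : ∃ θ, θ = δ * β / R ^ 18 := ⟨_, rfl⟩
  have hθ0 : 0 < θ := by rw [hθ]; positivity
  have hF : ∀ ρ : ℝ, ∃ F : ℕ → ℕ → (ℝ × ℝ) × ℝ → ℝ × ℝ × ℝ,
      (∀ m k b, 0 < max |(F m k b).1| |(F m k b).2.1|) ∧ (0 < ρ →
      ∀ (b : ℕ → (ℝ × ℝ) × ℝ) (z : ℝ × ℝ),
        (∀ m, z ∈ closedBall (b m).1 (b m).2 ∧ (b m).2 ≤ ρ / R ^ m) →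
        (∀ m k, k ≤ m → z ∉ affineStrip (F m k (b m)) (θ * ρ / R ^ (m + k))) →
        z ∈ badPair s t) := by
    intro ρ
    by_cases hρ : 0 < ρ
    · obtain ⟨F, h1, h2⟩ := exists_strips hs ht hst hR1 hθ0 hρ
      exact ⟨F, h1, fun _ => h2⟩
    · exact ⟨fun _ _ _ => (1, 0, 0), by simp, fun h => absurd h hρ⟩
  choose F hF0 hF1 using hF
  refine isHAWWin_of_strips hβ0 (by linarith) (by rw [hδ]; linarith) hδ0 ?_ hθ0 ?_ hF0 hF1
  · apply le_of_eq
    rw [hR]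
    field_simp
  · apply le_of_eq
    rw [hθ]
    field_simp
end

section
/- If a set S ⊆ ℝ^d is hyperplane potential winning (i.e., (β,c)-hyperplane potential winning for all β, c > 0), then S is hyperplane absolute winning (i.e., β-hyperplane absolute winning for all 0 < β < 1/(d+1), in particular for all 0 < β < 1/3 when d = 2). -/
open Metric Filter

/-- An affine hyperplane in ℝ^d: a nonempty affine subspace whose direction has
dimension `d - 1`. -/
def IsHyperplane {d : ℕ} (H : AffineSubspace ℝ (EuclideanSpace ℝ (Fin d))) : Prop :=
  (H : Set (EuclideanSpace ℝ (Fin d))).Nonempty ∧ Module.finrank ℝ H.direction = d - 1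

/-- The closed `γ`-thickening `H^(γ) = {p : dist(p, H) ≤ γ}` of a hyperplane `H` in ℝ^d. -/
noncomputable def hypNbhd {d : ℕ} (H : AffineSubspace ℝ (EuclideanSpace ℝ (Fin d))) (γ : ℝ) :
    Set (EuclideanSpace ℝ (Fin d)) :=
  {p | Metric.infDist p (H : Set (EuclideanSpace ℝ (Fin d))) ≤ γ}

/-- Alice has a winning strategy for the `β`-hyperplane absolute game on ℝ^d with target `S`.
A strategy for Alice assigns to each history of Bob's balls (represented as
(center, radius) pairs `h 0, …, h n`) a pair (hyperplane, radius of thickening).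
The strategy must be legal: whenever Bob's last ball has positive radius, Alice's move is a
hyperplane `L` together with `0 < r̃ ≤ β rₙ`.  It is winning if for every sequence of moves of
Bob obeying the rules (`B₀` has positive radius, `r_{n+1} ≥ β rₙ`, and
`B_{n+1} ⊆ Bₙ \ Lₙ^{(r̃ₙ)}`), either the radii do not tend to `0` (Alice wins by default) or
every point of `⋂ₙ Bₙ` (i.e. the outcome) belongs to `S`. -/
def IsHAWWinD (d : ℕ) (β : ℝ) (S : Set (EuclideanSpace ℝ (Fin d))) : Prop :=
  ∃ σ : (n : ℕ) → (Fin (n + 1) → EuclideanSpace ℝ (Fin d) × ℝ) →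
      AffineSubspace ℝ (EuclideanSpace ℝ (Fin d)) × ℝ,
    (∀ (n : ℕ) (h : Fin (n + 1) → EuclideanSpace ℝ (Fin d) × ℝ), 0 < (h (Fin.last n)).2 →
      IsHyperplane (σ n h).1 ∧ 0 < (σ n h).2 ∧ (σ n h).2 ≤ β * (h (Fin.last n)).2) ∧
    ∀ B : ℕ → EuclideanSpace ℝ (Fin d) × ℝ, 0 < (B 0).2 →
      (∀ n : ℕ, β * (B n).2 ≤ (B (n + 1)).2 ∧
        closedBall (B (n + 1)).1 (B (n + 1)).2 ⊆
          closedBall (B n).1 (B n).2 \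
            hypNbhd (σ n (fun i => B i.1)).1 (σ n (fun i => B i.1)).2) →
      (¬ Tendsto (fun n => (B n).2) atTop (nhds 0)) ∨
        ∀ x : EuclideanSpace ℝ (Fin d), (∀ n : ℕ, x ∈ closedBall (B n).1 (B n).2) → x ∈ S

/-- Alice has a winning strategy for the `(β,c)`-hyperplane potential game on ℝ^d with target
set `S`.  A strategy for Alice assigns to each history of Bob's balls a countable collection
(indexed by `ℕ`) of pairs (hyperplane `L_{i,n}`, thickening radius `r_{i,n}`); entries of
radius `0` represent no chosen set, so that finite collections are allowed.  The strategy
must be legal: whenever Bob's last ball has positive radius `rₙ`, each chosen entry with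
positive radius is a hyperplane, and `Σᵢ r_{i,n}^c ≤ (β rₙ)^c` (in particular the series
converges).  It is winning if for every sequence of moves of Bob obeying the rules (`B₀` has
positive radius, `r_{n+1} ≥ β rₙ`, `B_{n+1} ⊆ Bₙ`), either the radii do not tend to `0`
(Alice wins by default), or every point of `⋂ₙ Bₙ` (i.e. the outcome) belongs to `S` or to
one of the thickened hyperplanes `L_{i,n}^{(r_{i,n})}` chosen by Alice during the game (in
which case she also wins by default). -/
def IsHPWWinD (d : ℕ) (β c : ℝ) (S : Set (EuclideanSpace ℝ (Fin d))) : Prop :=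
  ∃ σ : (n : ℕ) → (Fin (n + 1) → EuclideanSpace ℝ (Fin d) × ℝ) → ℕ →
      AffineSubspace ℝ (EuclideanSpace ℝ (Fin d)) × ℝ,
    (∀ (n : ℕ) (h : Fin (n + 1) → EuclideanSpace ℝ (Fin d) × ℝ), 0 < (h (Fin.last n)).2 →
      (∀ i : ℕ, 0 ≤ (σ n h i).2 ∧ (0 < (σ n h i).2 → IsHyperplane (σ n h i).1)) ∧
      Summable (fun i : ℕ => (σ n h i).2 ^ c) ∧
      (∑' i : ℕ, (σ n h i).2 ^ c) ≤ (β * (h (Fin.last n)).2) ^ c) ∧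
    ∀ B : ℕ → EuclideanSpace ℝ (Fin d) × ℝ, 0 < (B 0).2 →
      (∀ n : ℕ, β * (B n).2 ≤ (B (n + 1)).2 ∧
        closedBall (B (n + 1)).1 (B (n + 1)).2 ⊆ closedBall (B n).1 (B n).2) →
      (¬ Tendsto (fun n => (B n).2) atTop (nhds 0)) ∨
        ∀ x : EuclideanSpace ℝ (Fin d), (∀ n : ℕ, x ∈ closedBall (B n).1 (B n).2) →
          (x ∈ S ∨ ∃ (n : ℕ) (i : ℕ), 0 < (σ n (fun j => B j.1) i).2 ∧
            x ∈ hypNbhd (σ n (fun j => B j.1) i).1 (σ n (fun j => B j.1) i).2)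

/-- Near a ball, sets are classified by their distance functions up to a relative error `ε`
using finitely many classes, whose number does not depend on the ball. -/
lemma exists_infDist_classification {E : Type*} [NormedAddCommGroup E] [NormedSpace ℝ E]
    [ProperSpace E] {ε : ℝ} (hε : 0 < ε) :
    ∃ N : ℕ, 0 < N ∧ ∀ (x : E) (r : ℝ), 0 < r → ∃ f : Set E → Fin N, ∀ L L' : Set E,
      infDist x L ≤ 2 * r → infDist x L' ≤ 2 * r → f L = f L' →
      ∀ p ∈ closedBall x r, infDist p L ≤ infDist p L' + ε * r := by
  classical
  obtain ⟨F, hF1, hFfin, hFcov⟩ :=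
    finite_cover_balls_of_compact (isCompact_closedBall (0 : E) 1) (show 0 < ε / 4 by positivity)
  have : Fintype F := hFfin.fintype
  set M := ⌊3 / (ε / 4)⌋₊
  let e := Fintype.equivFin (F → Fin (M + 1))
  refine ⟨Fintype.card (F → Fin (M + 1)), Fintype.card_pos, fun x r hr => ?_⟩
  let g (L : Set E) (q : F) : ℕ := ⌊infDist (x + r • (q : E)) L / (ε / 4 * r)⌋₊
  refine ⟨fun L => e fun q => Fin.ofNat (M + 1) (g L q), fun L L' hL hL' hLL' p hp => ?_⟩
  have hg (L : Set E) (hL : infDist x L ≤ 2 * r) (q : F) : g L q < M + 1 := by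
    have hq : ‖(q : E)‖ ≤ 1 := by simpa using hF1 q.2
    have h1 : infDist (x + r • (q : E)) L ≤ 3 * r := by
      have h2 : dist (x + r • (q : E)) x ≤ r := by
        rw [dist_eq_norm, add_sub_cancel_left, norm_smul, Real.norm_of_nonneg hr.le]
        nlinarith
      linarith [infDist_le_infDist_add_dist (s := L) (x := x + r • (q : E)) (y := x)]
    refine Nat.lt_succ_of_le (Nat.floor_le_floor ?_)
    rw [div_le_div_iff₀ (by positivity) (by positivity)]
    nlinarith [mul_le_mul_of_nonneg_right h1 (show 0 ≤ ε / 4 by positivity)]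
  have hq0 : r⁻¹ • (p - x) ∈ closedBall (0 : E) 1 := by
    rw [mem_closedBall_zero_iff, norm_smul, norm_inv, Real.norm_of_nonneg hr.le,
      inv_mul_le_iff₀ hr, mul_one, ← dist_eq_norm]
    exact hp
  obtain ⟨q, hqF, hq⟩ := Set.mem_iUnion₂.1 (hFcov hq0)
  have hfloor : g L ⟨q, hqF⟩ = g L' ⟨q, hqF⟩ := by
    have h1 := congrArg Fin.val (congrFun (e.injective hLL') ⟨q, hqF⟩)
    simpa [Fin.ofNat, Nat.mod_eq_of_lt (hg L hL _), Nat.mod_eq_of_lt (hg L' hL' _)] using h1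
  have hdist : dist p (x + r • q) ≤ ε / 4 * r := by
    have h1 : p - (x + r • q) = r • (r⁻¹ • (p - x) - q) := by
      rw [smul_sub, smul_inv_smul₀ hr.ne']
      abel
    rw [dist_eq_norm, h1, norm_smul, Real.norm_of_nonneg hr.le, mul_comm, ← dist_eq_norm]
    exact mul_le_mul_of_nonneg_right (mem_ball.1 hq).le hr.le
  have hstep : infDist (x + r • q) L ≤ infDist (x + r • q) L' + ε / 4 * r := by
    have hpos : 0 < ε / 4 * r := by positivity
    have h1 := Nat.lt_floor_add_one (infDist (x + r • q) L / (ε / 4 * r))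
    have h2 := Nat.floor_le (a := infDist (x + r • q) L' / (ε / 4 * r))
      (div_nonneg infDist_nonneg hpos.le)
    have h3 : ⌊infDist (x + r • q) L / (ε / 4 * r)⌋₊ =
      ⌊infDist (x + r • q) L' / (ε / 4 * r)⌋₊ := hfloor
    rw [h3, div_lt_iff₀ hpos] at h1
    rw [le_div_iff₀ hpos] at h2
    linarith
  have h1 := infDist_le_infDist_add_dist (s := L) (x := p) (y := x + r • q)
  have h2 := infDist_le_infDist_add_dist (s := L') (x := x + r • q) (y := p)
  rw [dist_comm] at h2
  have : 0 < ε * r := by positivity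
  linarith

/-- Weighted pigeonhole principle. -/
lemma exists_tsum_div_le_tsum_fiber {ι : Type*} {N : ℕ} (hN : 0 < N) (w : ι → ENNReal)
    (f : ι → Fin N) : ∃ k, (∑' i, w i) / N ≤ ∑' i, if f i = k then w i else 0 := by
  have : Nonempty (Fin N) := ⟨⟨0, hN⟩⟩
  obtain ⟨k, -, hk⟩ := Finset.exists_max_image Finset.univ
    (fun k => ∑' i, if f i = k then w i else 0) Finset.univ_nonempty
  refine ⟨k, ENNReal.div_le_of_le_mul ?_⟩
  calc ∑' i, w i = ∑' i, ∑ j, if f i = j then w i else 0 := by simp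
    _ = ∑ j, ∑' i, if f i = j then w i else 0 :=
      Summable.tsum_finsetSum fun _ _ => ENNReal.summable
    _ ≤ ∑ _j : Fin N, ∑' i, if f i = k then w i else 0 := Finset.sum_le_sum hk
    _ = _ := by simp [mul_comm]

lemma exists_isHyperplane (d : ℕ) :
    ∃ H : AffineSubspace ℝ (EuclideanSpace ℝ (Fin d)), IsHyperplane H := by
  suffices ∃ W : Submodule ℝ (EuclideanSpace ℝ (Fin d)), Module.finrank ℝ W = d - 1 by
    obtain ⟨W, hW⟩ := this
    exact ⟨AffineSubspace.mk' 0 W, ⟨0, AffineSubspace.self_mem_mk' _ _⟩, by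
      rwa [AffineSubspace.direction_mk']⟩
  cases d with
  | zero => exact ⟨⊥, by simp⟩
  | succ n =>
    have : Fact (Module.finrank ℝ (EuclideanSpace ℝ (Fin (n + 1))) = n + 1) := ⟨by simp⟩
    exact ⟨(Submodule.span ℝ {EuclideanSpace.single 0 1})ᗮ, by
      simpa using Submodule.finrank_orthogonal_span_singleton (𝕜 := ℝ) (n := n)
        (v := EuclideanSpace.single (0 : Fin (n + 1)) (1 : ℝ)) (by simp)⟩

open Classical in
/-- The contribution of a thickened hyperplane to the potential of a set `T`: the `c`-th power of
its thickness if it meets `T`, and `0` otherwise. -/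
noncomputable def hypWeight {d : ℕ} (c : ℝ)
    (a : AffineSubspace ℝ (EuclideanSpace ℝ (Fin d)) × ℝ) (T : Set (EuclideanSpace ℝ (Fin d))) :
    ENNReal :=
  if 0 < a.2 ∧ (T ∩ hypNbhd a.1 a.2).Nonempty then ENNReal.ofReal (a.2 ^ c) else 0

/-- The potential of a set `T` with respect to a family of thickened hyperplanes. -/
noncomputable def hypPotential {d : ℕ} {ι : Type*} (c : ℝ)
    (a : ι → AffineSubspace ℝ (EuclideanSpace ℝ (Fin d)) × ℝ)
    (T : Set (EuclideanSpace ℝ (Fin d))) : ENNReal :=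
  ∑' i, hypWeight c (a i) T

section Potential

variable {d : ℕ} {ι : Type*} {c : ℝ}

lemma hypWeight_mono (a : AffineSubspace ℝ (EuclideanSpace ℝ (Fin d)) × ℝ)
    {T U : Set (EuclideanSpace ℝ (Fin d))} (h : T ⊆ U) : hypWeight c a T ≤ hypWeight c a U := by
  unfold hypWeight
  split_ifs with h1 h2
  · exact le_rfl
  · exact absurd ⟨h1.1, h1.2.mono (Set.inter_subset_inter_left _ h)⟩ h2
  · exact zero_le
  · exact le_rfl

lemma hypPotential_le_ofReal {a : ℕ → AffineSubspace ℝ (EuclideanSpace ℝ (Fin d)) × ℝ}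
    {b : ℝ} (h0 : ∀ i, 0 ≤ (a i).2) (hs : Summable fun i => (a i).2 ^ c)
    (hb : ∑' i, (a i).2 ^ c ≤ b) (T : Set (EuclideanSpace ℝ (Fin d))) :
    hypPotential c a T ≤ ENNReal.ofReal b := by
  refine le_trans ?_ (ENNReal.ofReal_le_ofReal hb)
  rw [ENNReal.ofReal_tsum_of_nonneg (fun i => Real.rpow_nonneg (h0 i) c) hs]
  refine ENNReal.tsum_le_tsum fun i => ?_
  unfold hypWeight
  split_ifs
  · exact le_rfl
  · exact zero_le

/-- If a thickened hyperplane meets a set whose potential is at most `b ^ c`, its thickness is at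
most `b`. -/
lemma thickness_le_of_hypPotential_le {a : ι → AffineSubspace ℝ (EuclideanSpace ℝ (Fin d)) × ℝ}
    {T : Set (EuclideanSpace ℝ (Fin d))} {b : ℝ} (hc : 0 < c) (hb : 0 ≤ b)
    (h : hypPotential c a T ≤ ENNReal.ofReal (b ^ c)) {i : ι} (hi : 0 < (a i).2)
    (hT : (T ∩ hypNbhd (a i).1 (a i).2).Nonempty) : (a i).2 ≤ b := by
  have h1 : hypWeight c (a i) T ≤ ENNReal.ofReal (b ^ c) := (ENNReal.le_tsum i).trans h
  rw [hypWeight, if_pos ⟨hi, hT⟩, ENNReal.ofReal_le_ofReal_iff (by positivity)] at h1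
  exact (Real.rpow_le_rpow_iff hi.le hb hc).1 h1

/-- Some hyperplane is such that deleting its neighbourhood from a ball removes a fixed proportion
of a small potential. -/
lemma exists_isHyperplane_potential_drop (d : ℕ) {β : ℝ} (hβ : 0 < β) (hβ1 : β ≤ 1) :
    ∃ N : ℕ, 0 < N ∧ ∀ {ι : Type} {c r : ℝ} {x : EuclideanSpace ℝ (Fin d)}
      {a : ι → AffineSubspace ℝ (EuclideanSpace ℝ (Fin d)) × ℝ}, 0 < c → 0 < r →
      (∀ i, 0 < (a i).2 → IsHyperplane (a i).1) →
      hypPotential c a (closedBall x r) ≤ ENNReal.ofReal ((β / 2 * r) ^ c) →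
      ∃ H, IsHyperplane H ∧ ∀ T ⊆ closedBall x r \ hypNbhd H (β * r),
        hypPotential c a T + hypPotential c a (closedBall x r) / N ≤
          hypPotential c a (closedBall x r) := by
  obtain ⟨N, hN, hclass⟩ := exists_infDist_classification (E := EuclideanSpace ℝ (Fin d))
    (show 0 < β / 2 by positivity)
  refine ⟨N, hN, fun {ι c r x a} hc hr ha hpot => ?_⟩
  have hmono (T) (hT : T ⊆ closedBall x r) (i : ι) := hypWeight_mono (c := c) (a i) hT
  obtain ⟨f, hf⟩ := hclass x r hr
  obtain ⟨k, hk⟩ := exists_tsum_div_le_tsum_fiber hN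
    (fun i => hypWeight c (a i) (closedBall x r)) (fun i => f (a i).1)
  by_cases hzero : ∀ i, f (a i).1 = k → hypWeight c (a i) (closedBall x r) = 0
  · obtain ⟨H, hH⟩ := exists_isHyperplane d
    refine ⟨H, hH, fun T hT => ?_⟩
    have h1 : hypPotential c a (closedBall x r) / N ≤ 0 := by
      refine hk.trans (le_of_eq (ENNReal.tsum_eq_zero.2 fun i => ?_))
      split_ifs with h
      exacts [hzero i h, rfl]
    rw [nonpos_iff_eq_zero.1 h1, add_zero]
    exact ENNReal.tsum_le_tsum (hmono T (hT.trans Set.sdiff_subset))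
  push Not at hzero
  obtain ⟨i₀, hi₀k, hi₀⟩ := hzero
  have hmeet {T} {i : ι} (h : hypWeight c (a i) T ≠ 0) :
      0 < (a i).2 ∧ (T ∩ hypNbhd (a i).1 (a i).2).Nonempty := by
    by_contra h'
    exact h (if_neg h')
  have hnear {i : ι} (h : hypWeight c (a i) (closedBall x r) ≠ 0) :
      (a i).2 ≤ β / 2 * r ∧ infDist x (a i).1 ≤ 2 * r := by
    obtain ⟨h1, h2⟩ := hmeet h
    have h3 := thickness_le_of_hypPotential_le hc (by positivity) hpot h1 h2
    obtain ⟨p, hp, hp'⟩ := h2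
    refine ⟨h3, ?_⟩
    have h4 := infDist_le_infDist_add_dist (s := ((a i).1 : Set (EuclideanSpace ℝ (Fin d))))
      (x := x) (y := p)
    rw [dist_comm] at h4
    have h5 : infDist p (a i).1 ≤ (a i).2 := hp'
    have h6 : dist p x ≤ r := hp
    nlinarith
  refine ⟨(a i₀).1, ha i₀ (hmeet hi₀).1, fun T hT => ?_⟩
  refine (add_le_add_right hk _).trans ?_
  rw [hypPotential, hypPotential, ← ENNReal.tsum_add]
  refine ENNReal.tsum_le_tsum fun i => ?_
  split_ifs with hik
  · suffices hypWeight c (a i) T = 0 by simp [this]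
    by_contra h
    have hB := hnear (fun h0 => h (nonpos_iff_eq_zero.1
      ((hmono T (hT.trans Set.sdiff_subset) i).trans_eq h0)))
    obtain ⟨-, p, hpT, hp⟩ := hmeet h
    refine (hT hpT).2 ?_
    have h1 := hf _ _ (hnear hi₀).2 hB.2 (hi₀k.trans hik.symm) p (hT hpT).1
    have h2 : infDist p (a i).1 ≤ (a i).2 := hp
    change infDist p (a i₀).1 ≤ β * r
    linarith [hB.1]
  · simpa using hmono T (hT.trans Set.sdiff_subset) i

end Potential

/-- Since `β ^ c` tends to `1` as `c` tends to `0`, a drop by the proportion `δ` beats the factor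
`β ^ c` for small `c`. -/
lemma exists_rpow_contraction {β δ : ℝ} (hβ : 0 < β) (hδ : 0 < δ) :
    ∃ c : ℝ, 0 < c ∧ 1 - δ ≤ (1 - δ / 2) * β ^ c := by
  have h1 : Tendsto (fun c : ℝ => (1 - δ / 2) * β ^ c) (nhdsWithin 0 (Set.Ioi 0))
      (nhds ((1 - δ / 2) * β ^ (0 : ℝ))) :=
    ((Real.continuous_const_rpow hβ.ne').continuousAt.tendsto.const_mul _).mono_left
      nhdsWithin_le_nhds
  have h2 := h1.eventually (lt_mem_nhds (show 1 - δ < (1 - δ / 2) * β ^ (0 : ℝ) by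
    rw [Real.rpow_zero]; linarith))
  obtain ⟨c, hc, hc0⟩ := (h2.and self_mem_nhdsWithin).exists
  exact ⟨c, hc0, hc.le⟩

/-- The thickened hyperplanes chosen by a strategy `σ` for the potential game up to the end of the
history `h`. -/
def movesAlong {α γ : Type*} (σ : (n : ℕ) → (Fin (n + 1) → α) → ℕ → γ) (n : ℕ)
    (h : Fin (n + 1) → α) (p : Fin (n + 1) × ℕ) : γ :=
  σ p.1 (fun j => h ⟨j, by omega⟩) p.2

lemma hypPotential_movesAlong {d : ℕ} {α : Type*} (c : ℝ)
    (σ : (n : ℕ) → (Fin (n + 1) → α) → ℕ → AffineSubspace ℝ (EuclideanSpace ℝ (Fin d)) × ℝ)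
    (B : ℕ → α) (n : ℕ) (T : Set (EuclideanSpace ℝ (Fin d))) :
    hypPotential c (movesAlong σ n fun i => B i.1) T =
      ∑ m ∈ Finset.range (n + 1), hypPotential c (σ m fun j => B j.1) T := by
  rw [← Fin.sum_univ_eq_sum_range (fun m => hypPotential c (σ m fun j => B j.1) T), hypPotential,
    ENNReal.tsum_prod', tsum_fintype]
  rfl

/-- **Hyperplane potential winning implies hyperplane absolute winning**: if `S ⊆ ℝ^d` is
`(β,c)`-hyperplane potential winning for all `β, c > 0`, then `S` is `β`-hyperplane absolute
winning for all `0 < β < 1/(d+1)`. -/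
theorem potential_winning_implies_absolute_winning (d : ℕ)
    (S : Set (EuclideanSpace ℝ (Fin d)))
    (h : ∀ β c : ℝ, 0 < β → 0 < c → IsHPWWinD d β c S) :
    ∀ β : ℝ, 0 < β → β < 1 / ((d : ℝ) + 1) → IsHAWWinD d β S := by
  intro β hβ hβd
  have hβ1 : β ≤ 1 :=
    hβd.le.trans ((div_le_one (by positivity)).2 (by linarith [d.cast_nonneg (α := ℝ)]))
  obtain ⟨N, hN, hdrop⟩ := exists_isHyperplane_potential_drop d hβ hβ1
  set δ : ℝ := 1 / N with hδdef
  have hN' : (1 : ℝ) ≤ N := by exact_mod_cast hN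
  have hδ : 0 < δ := by positivity
  have hδ1 : δ ≤ 1 := (div_le_one (by positivity)).2 hN'
  obtain ⟨c, hc, hcontr⟩ := exists_rpow_contraction hβ hδ
  set β' : ℝ := min β (β / 2 * (δ / 2) ^ (1 / c)) with hβ'def
  have hβ' : 0 < β' := by positivity
  have hnew {r : ℝ} (hr : 0 < r) : (β' * r) ^ c ≤ δ / 2 * (β / 2 * r) ^ c := by
    calc (β' * r) ^ c ≤ ((δ / 2) ^ (1 / c) * (β / 2 * r)) ^ c := by
          refine Real.rpow_le_rpow (by positivity) ?_ hc.le
          nlinarith [mul_le_mul_of_nonneg_right (min_le_right β (β / 2 * (δ / 2) ^ (1 / c))) hr.le]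
      _ = δ / 2 * (β / 2 * r) ^ c := by
          rw [Real.mul_rpow (by positivity) (by positivity), ← Real.rpow_mul (by positivity),
            one_div_mul_cancel hc.ne', Real.rpow_one]
  obtain ⟨σ, hσ, hwin⟩ := h β' c hβ' hc
  -- Alice deletes a hyperplane achieving the drop of potential whenever there is one.
  let good (n : ℕ) (g : Fin (n + 1) → EuclideanSpace ℝ (Fin d) × ℝ)
      (H : AffineSubspace ℝ (EuclideanSpace ℝ (Fin d))) : Prop :=
    ∀ T ⊆ closedBall (g (Fin.last n)).1 (g (Fin.last n)).2 \
        hypNbhd H (β * (g (Fin.last n)).2),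
      hypPotential c (movesAlong σ n g) T +
          hypPotential c (movesAlong σ n g)
            (closedBall (g (Fin.last n)).1 (g (Fin.last n)).2) / N ≤
        hypPotential c (movesAlong σ n g) (closedBall (g (Fin.last n)).1 (g (Fin.last n)).2)
  have hchoice (n : ℕ) (g : Fin (n + 1) → EuclideanSpace ℝ (Fin d) × ℝ) :
      ∃ H, IsHyperplane H ∧ ((∃ H', IsHyperplane H' ∧ good n g H') → good n g H) := by
    by_cases hg : ∃ H', IsHyperplane H' ∧ good n g H'
    · exact hg.imp fun H hH => ⟨hH.1, fun _ => hH.2⟩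
    · exact (exists_isHyperplane d).imp fun H hH => ⟨hH, fun hg' => absurd hg' hg⟩
  choose τ hτ hτgood using hchoice
  refine ⟨fun n g => (τ n g, β * (g (Fin.last n)).2),
    fun n g hg => ⟨hτ n g, by positivity, le_rfl⟩, fun B hB0 hB => ?_⟩
  have hr (n : ℕ) : 0 < (B n).2 := by
    induction n with
    | zero => exact hB0
    | succ n ih => exact (mul_pos hβ ih).trans_le (hB n).1
  have hfresh (n : ℕ) (T : Set (EuclideanSpace ℝ (Fin d))) :
      hypPotential c (σ n fun j => B j.1) T ≤
        ENNReal.ofReal (δ / 2 * (β / 2 * (B n).2) ^ c) := by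
    obtain ⟨h1, h2, h3⟩ := hσ n (fun j => B j.1) (hr n)
    exact hypPotential_le_ofReal (fun i => (h1 i).1) h2 (h3.trans (hnew (hr n))) T
  have hpot (n : ℕ) : hypPotential c (movesAlong σ n fun i => B i.1)
      (closedBall (B n).1 (B n).2) ≤ ENNReal.ofReal ((β / 2 * (B n).2) ^ c) := by
    induction n with
    | zero =>
      rw [hypPotential_movesAlong, zero_add, Finset.sum_range_one]
      refine (hfresh 0 _).trans (ENNReal.ofReal_le_ofReal ?_)
      have := hr 0
      exact mul_le_of_le_one_left (by positivity) (by linarith)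
    | succ n ih =>
      have hrn := hr n
      have hrn' := hr (n + 1)
      set Φ := hypPotential c (movesAlong σ n fun i => B i.1) (closedBall (B n).1 (B n).2) with hΦ
      set Ψ := hypPotential c (movesAlong σ n fun i => B i.1)
        (closedBall (B (n + 1)).1 (B (n + 1)).2) with hΨ
      have hdropn : Ψ + Φ / N ≤ Φ := by
        refine hτgood n (fun i => B i.1) (hdrop hc (hr n) (fun p hp => ?_) ih) _ (hB n).2
        exact ((hσ p.1 (fun j => B j.1) (hr _)).1 p.2).2 hp
      have hΦfin : Φ ≠ ⊤ := ne_top_of_le_ne_top ENNReal.ofReal_ne_top ih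
      have hΨ' : Ψ ≤ ENNReal.ofReal ((1 - δ) * (β / 2 * (B n).2) ^ c) := by
        have hΨfin : Ψ ≠ ⊤ := ne_top_of_le_ne_top hΦfin (le_self_add.trans hdropn)
        have h1 : Ψ.toReal + Φ.toReal / N ≤ Φ.toReal := by
          have h2 := ENNReal.toReal_mono hΦfin hdropn
          rwa [ENNReal.toReal_add hΨfin (ne_top_of_le_ne_top hΦfin (le_add_self.trans hdropn)),
            ENNReal.toReal_div, ENNReal.toReal_natCast] at h2
        have h3 : Φ.toReal ≤ (β / 2 * (B n).2) ^ c :=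
          ENNReal.toReal_le_of_le_ofReal (by positivity) ih
        rw [ENNReal.le_ofReal_iff_toReal_le hΨfin
          (mul_nonneg (by linarith) (by positivity))]
        have h4 : Φ.toReal / N = δ * Φ.toReal := by rw [hδdef]; ring
        nlinarith [mul_le_mul_of_nonneg_left h3 (show 0 ≤ 1 - δ by linarith)]
      have hscale : β ^ c * (β / 2 * (B n).2) ^ c ≤ (β / 2 * (B (n + 1)).2) ^ c := by
        rw [← Real.mul_rpow hβ.le (by positivity)]
        refine Real.rpow_le_rpow (by positivity) ?_ hc.le
        nlinarith [(hB n).1]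
      rw [hypPotential_movesAlong, Finset.sum_range_succ, ← hypPotential_movesAlong]
      refine (add_le_add hΨ' (hfresh (n + 1) _)).trans ?_
      rw [← ENNReal.ofReal_add (mul_nonneg (by linarith) (by positivity)) (by positivity)]
      refine ENNReal.ofReal_le_ofReal ?_
      have h1 := mul_le_mul_of_nonneg_right hcontr
        (show 0 ≤ (β / 2 * (B n).2) ^ c by positivity)
      have h2 := mul_le_mul_of_nonneg_left hscale (show 0 ≤ 1 - δ / 2 by linarith)
      linarith
  refine or_iff_not_imp_left.2 fun hlim x hx => ?_
  rw [not_not] at hlim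
  have hlegal (n : ℕ) : β' * (B n).2 ≤ (B (n + 1)).2 ∧
      closedBall (B (n + 1)).1 (B (n + 1)).2 ⊆ closedBall (B n).1 (B n).2 :=
    ⟨(mul_le_mul_of_nonneg_right (min_le_left _ _) (hr n).le).trans (hB n).1,
      (hB n).2.trans Set.sdiff_subset⟩
  obtain hwin | hwin := hwin B hB0 hlegal
  · exact absurd hlim hwin
  obtain hxS | ⟨n, i, hpos, hxi⟩ := hwin x hx
  · exact hxS
  -- A hyperplane through the outcome would have thickness bounded by vanishing radii.
  have hle (m : ℕ) (hm : n ≤ m) : (σ n (fun j => B j.1) i).2 ≤ β / 2 * (B m).2 :=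
    thickness_le_of_hypPotential_le (i := ((⟨n, by omega⟩ : Fin (m + 1)), i)) hc
      (by have := hr m; positivity) (hpot m) hpos ⟨x, hx m, hxi⟩
  have hle0 : (σ n (fun j => B j.1) i).2 ≤ β / 2 * 0 :=
    ge_of_tendsto (hlim.const_mul _) (eventually_atTop.2 ⟨n, hle⟩)
  linarith
end
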